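/- arXiv:math/0312479 — 2 statements merged into one kernel-verified Lean document; each statement's English description precedes it below -/
import Mathlib

section
/- Commutator estimate for the reduced wave operator (Corollary 7.6, eq. (7.13)): there is a universal constant C such that the following holds. Let H = (H^{αβ}) be a smooth symmetric tensor field on ℝ^{1+3}, □̃_g = □ + H^{αβ}∂_α∂_β, Z ∈ 𝒵 and Ẑ = Z + c_Z (with c_S = 2, c_Z = 0 otherwise). Then for every smooth φ, at every point with t ≥ 0 and x ≠ 0, |□̃_g Zφ − Ẑ □̃_g φ| ≤ C ( (|H| + |ZH|)/(1 + t + |q|) + (|ZH|_{LL} + |H|_{L𝒯})/(1 + |q|) ) Σ_{|I| ≤ 1} |∂ Z^I φ|, where ZH denotes the tensor with components Z(H^{αβ}) and q = r − t. -/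
open scoped BigOperators ENNReal
open MeasureTheory

noncomputable section

namespace LindbladRodnianski

/-- Minkowski metric `diag(-1,1,1,1)` (numerically the same with indices up or down). -/
def mink (α β : Fin 4) : ℝ := if α = β then (if α = 0 then -1 else 1) else 0

/-- spatial part of a spacetime point -/
def sp (y : Fin 4 → ℝ) : Fin 3 → ℝ := fun i => y i.succ

/-- Euclidean norm on `Fin 3 → ℝ` -/
def nr3 (x : Fin 3 → ℝ) : ℝ := Real.sqrt (∑ i : Fin 3, x i ^ 2)

/-- r = |x| -/
def rad (y : Fin 4 → ℝ) : ℝ := nr3 (sp y)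

/-- the unit spatial direction ω = x/|x| -/
def uom (y : Fin 4 → ℝ) : Fin 3 → ℝ := fun i => sp y i / rad y

/-- q = r - t -/
def qq (y : Fin 4 → ℝ) : ℝ := rad y - y 0

/-- combine a time and a space point into a spacetime point -/
def tins (t : ℝ) (x : Fin 3 → ℝ) : Fin 4 → ℝ := Fin.cons t x

/-- L = (1, ω) (indices up) -/
def vecL (ω : Fin 3 → ℝ) : Fin 4 → ℝ := ![1, ω 0, ω 1, ω 2]
/-- L̄ = (1, -ω) (indices up) -/
def vecLb (ω : Fin 3 → ℝ) : Fin 4 → ℝ := ![1, -ω 0, -ω 1, -ω 2]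
/-- L with index lowered by m -/
def vecLlow (ω : Fin 3 → ℝ) : Fin 4 → ℝ := ![-1, ω 0, ω 1, ω 2]
/-- L̄ with index lowered by m -/
def vecLblow (ω : Fin 3 → ℝ) : Fin 4 → ℝ := ![-1, -ω 0, -ω 1, -ω 2]
/-- a spatial vector viewed as a spacetime vector -/
def spat (s : Fin 3 → ℝ) : Fin 4 → ℝ := ![0, s 0, s 1, s 2]

/-- `ω, s₁, s₂` is an (ordered) orthonormal frame of ℝ³;
equivalently `s₁, s₂` is an orthonormal basis of the plane orthogonal to the unit vector ω. -/
def IsFrame (ω s₁ s₂ : Fin 3 → ℝ) : Prop :=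
  (∑ i : Fin 3, ω i * ω i) = 1 ∧ (∑ i : Fin 3, s₁ i * s₁ i) = 1 ∧
  (∑ i : Fin 3, s₂ i * s₂ i) = 1 ∧ (∑ i : Fin 3, s₁ i * s₂ i) = 0 ∧
  (∑ i : Fin 3, ω i * s₁ i) = 0 ∧ (∑ i : Fin 3, ω i * s₂ i) = 0

/-- contraction of a 2-tensor with two vectors: `p_{αβ} U^α V^β` -/
def con2 (p : Fin 4 → Fin 4 → ℝ) (U V : Fin 4 → ℝ) : ℝ :=
  ∑ α : Fin 4, ∑ β : Fin 4, p α β * U α * V β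

/-- Euclidean norm of a 2-tensor -/
def tnorm (p : Fin 4 → Fin 4 → ℝ) : ℝ :=
  Real.sqrt (∑ α : Fin 4, ∑ β : Fin 4, (p α β) ^ 2)

/-- coordinate derivative ∂_α f -/
def pd (f : (Fin 4 → ℝ) → ℝ) (α : Fin 4) (y : Fin 4 → ℝ) : ℝ :=
  fderiv ℝ f y (Pi.single α 1)

/-- ∂_α ∂_β f -/
def pd2 (f : (Fin 4 → ℝ) → ℝ) (α β : Fin 4) (y : Fin 4 → ℝ) : ℝ :=
  pd (pd f β) α y

/-- |∂f| -/
def dnorm (f : (Fin 4 → ℝ) → ℝ) (y : Fin 4 → ℝ) : ℝ :=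
  Real.sqrt (∑ α : Fin 4, (pd f α y) ^ 2)

/-- ω extended by ω₀ = 0 to a spacetime vector -/
def uom4 (y : Fin 4 → ℝ) : Fin 4 → ℝ := spat (uom y)

/-- radial derivative ∂_r f = ω^j ∂_j f -/
def pdr (f : (Fin 4 → ℝ) → ℝ) (y : Fin 4 → ℝ) : ℝ :=
  ∑ α : Fin 4, uom4 y α * pd f α y

/-- ∂_q = ½(∂_r - ∂_t) -/
def pdq (f : (Fin 4 → ℝ) → ℝ) (y : Fin 4 → ℝ) : ℝ := (pdr f y - pd f 0 y) / 2

/-- ∂_s = ½(∂_t + ∂_r) -/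
def pds (f : (Fin 4 → ℝ) → ℝ) (y : Fin 4 → ℝ) : ℝ := (pd f 0 y + pdr f y) / 2

/-- the tangential derivatives: index 0 is ∂_s, index i.succ is ∂̄_i = ∂_i - ω_i ω^j ∂_j -/
def tpd (f : (Fin 4 → ℝ) → ℝ) (a : Fin 4) (y : Fin 4 → ℝ) : ℝ :=
  if a = 0 then pds f y else pd f a y - uom4 y a * pdr f y

/-- |∂̄f| -/
def tdnorm (f : (Fin 4 → ℝ) → ℝ) (y : Fin 4 → ℝ) : ℝ :=
  Real.sqrt (∑ a : Fin 4, (tpd f a y) ^ 2)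

/-- coordinates with the index lowered: x₀ = -t, x_i = xⁱ -/
def lowerc (y : Fin 4 → ℝ) (α : Fin 4) : ℝ := if α = 0 then -(y 0) else y α

/-- the translation vector field ∂_μ (its coefficients) -/
def dVF (μ : Fin 4) : (Fin 4 → ℝ) → Fin 4 → ℝ := fun _ => Pi.single μ 1

/-- the rotation/boost field Ω_{ab} = x_a ∂_b - x_b ∂_a (its coefficients) -/
def omVF (a b : Fin 4) : (Fin 4 → ℝ) → Fin 4 → ℝ :=
  fun y ν => lowerc y a * (if ν = b then (1:ℝ) else 0) - lowerc y b * (if ν = a then (1:ℝ) else 0)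

/-- the scaling field S = t∂_t + x^i∂_i (its coefficients) -/
def sVF : (Fin 4 → ℝ) → Fin 4 → ℝ := fun y => y

/-- the family 𝒵 of Minkowski vector fields -/
def ZV : Fin 11 → (Fin 4 → ℝ) → Fin 4 → ℝ :=
  ![dVF 0, dVF 1, dVF 2, dVF 3,
    omVF 0 1, omVF 0 2, omVF 0 3, omVF 1 2, omVF 1 3, omVF 2 3, sVF]

/-- apply a vector field (given by its coefficients) to a function -/
def Zap (Zc : (Fin 4 → ℝ) → Fin 4 → ℝ) (f : (Fin 4 → ℝ) → ℝ) (y : Fin 4 → ℝ) : ℝ :=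
  ∑ μ : Fin 4, Zc y μ * pd f μ y

/-- the Minkowski wave operator □ = m^{αβ}∂_α∂_β = -∂_t² + Δ -/
def box (f : (Fin 4 → ℝ) → ℝ) (y : Fin 4 → ℝ) : ℝ :=
  ∑ α : Fin 4, ∑ β : Fin 4, mink α β * pd2 f α β y

/-- the reduced wave operator □̃_g = □ + H^{αβ}∂_α∂_β with g = m + H (indices up) -/
def boxg (H : (Fin 4 → ℝ) → Fin 4 → Fin 4 → ℝ) (f : (Fin 4 → ℝ) → ℝ) (y : Fin 4 → ℝ) : ℝ :=
  box f y + ∑ α : Fin 4, ∑ β : Fin 4, H y α β * pd2 f α β y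

/-- |k|_{L𝒯} for an index-up 2-tensor (contractions with lowered frame vectors) -/
def normLT (k : Fin 4 → Fin 4 → ℝ) (ω s₁ s₂ : Fin 3 → ℝ) : ℝ :=
  |con2 k (vecLlow ω) (vecLlow ω)| + |con2 k (vecLlow ω) (spat s₁)| +
    |con2 k (vecLlow ω) (spat s₂)|

/-- the region D_t = {x : t/2 ≤ |x| ≤ 2t} -/
def Dreg (t : ℝ) : Set (Fin 3 → ℝ) := {x | t / 2 ≤ nr3 x ∧ nr3 x ≤ 2 * t}


lemma abs_le_tnorm (p : Fin 4 → Fin 4 → ℝ) (α β : Fin 4) : |p α β| ≤ tnorm p := by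
  refine Real.abs_le_sqrt ?_
  calc p α β ^ 2 ≤ ∑ b : Fin 4, p α b ^ 2 :=
        Finset.single_le_sum (f := fun b => p α b ^ 2) (fun _ _ => sq_nonneg _) (Finset.mem_univ β)
    _ ≤ _ := Finset.single_le_sum (f := fun a => ∑ b : Fin 4, p a b ^ 2)
        (fun _ _ => Finset.sum_nonneg fun _ _ => sq_nonneg _) (Finset.mem_univ α)

lemma abs_pd_le_dnorm (f : (Fin 4 → ℝ) → ℝ) (α : Fin 4) (y : Fin 4 → ℝ) :
    |pd f α y| ≤ dnorm f y :=
  Real.abs_le_sqrt (Finset.single_le_sum (f := fun a => pd f a y ^ 2)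
    (fun _ _ => sq_nonneg _) (Finset.mem_univ α))

lemma contDiff_pd {f : (Fin 4 → ℝ) → ℝ} (hf : ContDiff ℝ (⊤ : ℕ∞) f) (α : Fin 4) :
    ContDiff ℝ (⊤ : ℕ∞) (pd f α) :=
  (hf.fderiv_right (m := (⊤ : ℕ∞)) (by simp)).clm_apply contDiff_const

lemma differentiableAt_of_smooth {f : (Fin 4 → ℝ) → ℝ} (hf : ContDiff ℝ (⊤ : ℕ∞) f)
    (y : Fin 4 → ℝ) : DifferentiableAt ℝ f y :=
  (hf.differentiable (by simp)) y

lemma pd2_symm {f : (Fin 4 → ℝ) → ℝ} (hf : ContDiff ℝ (⊤ : ℕ∞) f) (α β : Fin 4)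
    (y : Fin 4 → ℝ) : pd2 f α β y = pd2 f β α y := by
  have hd : DifferentiableAt ℝ (fderiv ℝ f) y :=
    ((hf.fderiv_right (m := (⊤ : ℕ∞)) (by simp)).differentiable (by simp)) y
  have h : ∀ a b : Fin 4, pd2 f a b y
      = fderiv ℝ (fderiv ℝ f) y (Pi.single a 1) (Pi.single b 1) := by
    intro a b
    have : pd f b = fun z => fderiv ℝ f z (Pi.single b 1) := rfl
    rw [pd2, this, pd, fderiv_clm_apply hd (differentiableAt_const _)]
    simp
  rw [h, h]
  exact (hf.contDiffAt.isSymmSndFDerivAt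
    (by simpa using WithTop.coe_le_coe.mpr (le_top : (2 : ℕ∞) ≤ ⊤))) _ _

lemma pd_mul {f g : (Fin 4 → ℝ) → ℝ} {y : Fin 4 → ℝ} (hf : DifferentiableAt ℝ f y)
    (hg : DifferentiableAt ℝ g y) (α : Fin 4) :
    pd (fun z => f z * g z) α y = pd f α y * g y + f y * pd g α y := by
  simp only [pd]
  rw [fderiv_fun_mul hf hg]
  simp
  ring

lemma pd_add {f g : (Fin 4 → ℝ) → ℝ} {y : Fin 4 → ℝ} (hf : DifferentiableAt ℝ f y)
    (hg : DifferentiableAt ℝ g y) (α : Fin 4) :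
    pd (fun z => f z + g z) α y = pd f α y + pd g α y := by
  simp only [pd]
  rw [fderiv_fun_add hf hg]
  simp

lemma pd_sum {ι : Type*} [Fintype ι] {f : ι → (Fin 4 → ℝ) → ℝ} {y : Fin 4 → ℝ}
    (hf : ∀ i, DifferentiableAt ℝ (f i) y) (α : Fin 4) :
    pd (fun z => ∑ i, f i z) α y = ∑ i, pd (f i) α y := by
  simp only [pd]
  rw [fderiv_fun_sum fun i _ => hf i]
  simp

lemma pd_const_mul {f : (Fin 4 → ℝ) → ℝ} {y : Fin 4 → ℝ} (c : ℝ)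
    (hf : DifferentiableAt ℝ f y) (α : Fin 4) :
    pd (fun z => c * f z) α y = c * pd f α y := by
  simp only [pd]
  rw [fderiv_const_mul hf]
  simp

/-- The affine vector field with coefficients `b ν + ∑ μ, y μ * a μ ν`. -/
def affVF (b : Fin 4 → ℝ) (a : Fin 4 → Fin 4 → ℝ) : (Fin 4 → ℝ) → Fin 4 → ℝ :=
  fun y ν => b ν + ∑ μ : Fin 4, y μ * a μ ν

lemma contDiff_affVF (b : Fin 4 → ℝ) (a : Fin 4 → Fin 4 → ℝ) (ν : Fin 4) :
    ContDiff ℝ (⊤ : ℕ∞) (fun y => affVF b a y ν) := by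
  unfold affVF
  fun_prop

lemma pd_affVF (b : Fin 4 → ℝ) (a : Fin 4 → Fin 4 → ℝ) (ν α : Fin 4) (y : Fin 4 → ℝ) :
    pd (fun z => affVF b a z ν) α y = a α ν := by
  have h : HasFDerivAt (fun z => affVF b a z ν)
      (∑ μ : Fin 4, (a μ ν) • (ContinuousLinearMap.proj (R := ℝ) (φ := fun _ : Fin 4 => ℝ) μ)) y := by
    unfold affVF
    refine HasFDerivAt.const_add _ (HasFDerivAt.fun_sum fun μ _ => ?_)
    exact (hasFDerivAt_apply (𝕜 := ℝ) μ y).mul_const (a μ ν)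
  rw [pd, h.fderiv]
  simp [Pi.single_apply]

lemma contDiff_Zap_affVF (b : Fin 4 → ℝ) (a : Fin 4 → Fin 4 → ℝ) {f : (Fin 4 → ℝ) → ℝ}
    (hf : ContDiff ℝ (⊤ : ℕ∞) f) : ContDiff ℝ (⊤ : ℕ∞) (Zap (affVF b a) f) := by
  unfold Zap
  exact ContDiff.sum fun μ _ => (contDiff_affVF b a μ).mul (contDiff_pd hf μ)

lemma pd_Zap (b : Fin 4 → ℝ) (a : Fin 4 → Fin 4 → ℝ) {f : (Fin 4 → ℝ) → ℝ}
    (hf : ContDiff ℝ (⊤ : ℕ∞) f) (β : Fin 4) (y : Fin 4 → ℝ) :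
    pd (Zap (affVF b a) f) β y = Zap (affVF b a) (pd f β) y + ∑ μ : Fin 4, a β μ * pd f μ y := by
  have hZ : Zap (affVF b a) f = fun z => ∑ μ : Fin 4, affVF b a z μ * pd f μ z := rfl
  have h1 : ∀ μ, DifferentiableAt ℝ (fun z => affVF b a z μ) y := fun μ =>
    differentiableAt_of_smooth (contDiff_affVF b a μ) y
  have h2 : ∀ μ, DifferentiableAt ℝ (pd f μ) y := fun μ =>
    differentiableAt_of_smooth (contDiff_pd hf μ) y
  rw [hZ, pd_sum fun μ => (h1 μ).fun_mul (h2 μ), Zap, ← Finset.sum_add_distrib]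
  refine Finset.sum_congr rfl fun μ _ => ?_
  rw [pd_mul (h1 μ) (h2 μ), pd_affVF]
  have := pd2_symm hf β μ y
  simp only [pd2] at this
  rw [this]
  ring

lemma pd2_Zap (b : Fin 4 → ℝ) (a : Fin 4 → Fin 4 → ℝ) {f : (Fin 4 → ℝ) → ℝ}
    (hf : ContDiff ℝ (⊤ : ℕ∞) f) (α β : Fin 4) (y : Fin 4 → ℝ) :
    pd2 (Zap (affVF b a) f) α β y = Zap (affVF b a) (pd2 f α β) y
      + ∑ μ : Fin 4, a α μ * pd2 f μ β y + ∑ μ : Fin 4, a β μ * pd2 f α μ y := by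
  have h2 : ∀ μ, DifferentiableAt ℝ (pd f μ) y := fun μ =>
    differentiableAt_of_smooth (contDiff_pd hf μ) y
  have hfun : pd (Zap (affVF b a) f) β
      = fun z => Zap (affVF b a) (pd f β) z + ∑ μ : Fin 4, a β μ * pd f μ z :=
    funext fun z => pd_Zap b a hf β z
  rw [pd2, hfun, pd_add (differentiableAt_of_smooth (contDiff_Zap_affVF b a (contDiff_pd hf β)) y)
      (DifferentiableAt.fun_sum fun μ _ => (h2 μ).const_mul _),
    pd_Zap b a (contDiff_pd hf β), pd_sum fun μ => (h2 μ).const_mul _]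
  simp only [pd_const_mul _ (h2 _)]
  rfl

lemma Zap_mul (Zc : (Fin 4 → ℝ) → Fin 4 → ℝ) {f g : (Fin 4 → ℝ) → ℝ} {y : Fin 4 → ℝ}
    (hf : DifferentiableAt ℝ f y) (hg : DifferentiableAt ℝ g y) :
    Zap Zc (fun z => f z * g z) y = Zap Zc f y * g y + f y * Zap Zc g y := by
  simp only [Zap, pd_mul hf hg, Finset.sum_mul, Finset.mul_sum, ← Finset.sum_add_distrib]
  exact Finset.sum_congr rfl fun μ _ => by ring

lemma Zap_sum {ι : Type*} [Fintype ι] (Zc : (Fin 4 → ℝ) → Fin 4 → ℝ)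
    {f : ι → (Fin 4 → ℝ) → ℝ} {y : Fin 4 → ℝ} (hf : ∀ i, DifferentiableAt ℝ (f i) y) :
    Zap Zc (fun z => ∑ i, f i z) y = ∑ i, Zap Zc (f i) y := by
  simp only [Zap, pd_sum hf, Finset.mul_sum]
  exact Finset.sum_comm

lemma boxg_eq (H : (Fin 4 → ℝ) → Fin 4 → Fin 4 → ℝ) (f : (Fin 4 → ℝ) → ℝ) (y : Fin 4 → ℝ) :
    boxg H f y = ∑ α : Fin 4, ∑ β : Fin 4, (mink α β + H y α β) * pd2 f α β y := by
  simp only [boxg, box, ← Finset.sum_add_distrib, add_mul]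

lemma Zap_boxg (Zc : (Fin 4 → ℝ) → Fin 4 → ℝ) {H : (Fin 4 → ℝ) → Fin 4 → Fin 4 → ℝ}
    (hH : ∀ α β, ContDiff ℝ (⊤ : ℕ∞) (fun y => H y α β)) {f : (Fin 4 → ℝ) → ℝ}
    (hf : ContDiff ℝ (⊤ : ℕ∞) f) (y : Fin 4 → ℝ) :
    Zap Zc (boxg H f) y = ∑ α : Fin 4, ∑ β : Fin 4,
      (Zap Zc (fun z => H z α β) y * pd2 f α β y
        + (mink α β + H y α β) * Zap Zc (pd2 f α β) y) := by
  have hG : ∀ α β, DifferentiableAt ℝ (fun z => mink α β + H z α β) y := fun α β =>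
    (differentiableAt_of_smooth (hH α β) y).const_add _
  have hM : ∀ α β, DifferentiableAt ℝ (pd2 f α β) y := fun α β =>
    differentiableAt_of_smooth (contDiff_pd (contDiff_pd hf β) α) y
  have hGM : ∀ α β, DifferentiableAt ℝ (fun z => (mink α β + H z α β) * pd2 f α β z) y :=
    fun α β => (hG α β).mul (hM α β)
  have hfun : boxg H f
      = fun z => ∑ α : Fin 4, ∑ β : Fin 4, (mink α β + H z α β) * pd2 f α β z :=
    funext fun z => boxg_eq H f z
  have hc : ∀ α β, Zap Zc (fun z => mink α β + H z α β) y = Zap Zc (fun z => H z α β) y := by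
    intro α β
    simp [Zap, pd, fderiv_const_add]
  rw [hfun, Zap_sum Zc fun α => DifferentiableAt.fun_sum fun β _ => hGM α β]
  refine Finset.sum_congr rfl fun α _ => ?_
  rw [Zap_sum Zc fun β => hGM α β]
  refine Finset.sum_congr rfl fun β _ => ?_
  rw [Zap_mul Zc (hG α β) (hM α β), hc]

/-- The conformal Killing property `m^{αμ} ∂_α Z^ν + m^{αν} ∂_α Z^μ = c m^{μν}` of a field with
constant coefficient gradient `a`. -/
def IsConformalKilling (a : Fin 4 → Fin 4 → ℝ) (c : ℝ) : Prop :=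
  ∀ μ ν : Fin 4, mink μ μ * a μ ν + mink ν ν * a ν μ = c * mink μ ν

lemma sum_mink_eq_zero {a : Fin 4 → Fin 4 → ℝ} {c : ℝ} (ha : IsConformalKilling a c)
    {M : Fin 4 → Fin 4 → ℝ} (hM : ∀ α β, M α β = M β α) :
    ∑ α : Fin 4, ∑ β : Fin 4, mink α β *
      (∑ μ : Fin 4, a α μ * M μ β + ∑ μ : Fin 4, a β μ * M α μ - c * M α β) = 0 := by
  have h : ∑ μ : Fin 4, ∑ ν : Fin 4,
      (mink μ μ * a μ ν + mink ν ν * a ν μ - c * mink μ ν) * M μ ν = 0 :=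
    Finset.sum_eq_zero fun μ _ => Finset.sum_eq_zero fun ν _ => by rw [ha μ ν]; ring
  rw [← h]
  simp only [Fin.sum_univ_four, mink]
  simp only [hM 1 0, hM 2 0, hM 3 0, hM 2 1, hM 3 1, hM 3 2]
  simp
  ring

/-- The coefficients of the commutator of `H^{αβ} ∂_α ∂_β` with a field of gradient `a`, where
`k` is the derivative of `h` along the field. -/
def commCoeff (k h a : Fin 4 → Fin 4 → ℝ) (c : ℝ) (α β : Fin 4) : ℝ :=
  -k α β + ∑ μ : Fin 4, h μ β * a μ α + ∑ μ : Fin 4, h α μ * a μ β - c * h α β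

lemma boxg_commutator {b : Fin 4 → ℝ} {a : Fin 4 → Fin 4 → ℝ} {c : ℝ}
    (ha : IsConformalKilling a c) {H : (Fin 4 → ℝ) → Fin 4 → Fin 4 → ℝ}
    (hH : ∀ α β, ContDiff ℝ (⊤ : ℕ∞) (fun y => H y α β)) {f : (Fin 4 → ℝ) → ℝ}
    (hf : ContDiff ℝ (⊤ : ℕ∞) f) (y : Fin 4 → ℝ) :
    boxg H (Zap (affVF b a) f) y - (Zap (affVF b a) (boxg H f) y + c * boxg H f y)
      = ∑ α : Fin 4, ∑ β : Fin 4,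
        commCoeff (fun α β => Zap (affVF b a) (fun z => H z α β) y) (H y) a c α β
          * pd2 f α β y := by
  have hm := sum_mink_eq_zero ha (M := fun α β => pd2 f α β y) fun α β => pd2_symm hf α β y
  rw [Zap_boxg _ hH hf, boxg_eq, boxg_eq]
  simp only [pd2_Zap b a hf]
  have h1 : ∑ α : Fin 4, ∑ β : Fin 4, (∑ μ : Fin 4, H y μ β * a μ α) * pd2 f α β y
      = ∑ α : Fin 4, ∑ β : Fin 4, H y α β * ∑ μ : Fin 4, a α μ * pd2 f μ β y := by
    simp only [Fin.sum_univ_four]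
    ring
  have h2 : ∑ α : Fin 4, ∑ β : Fin 4, (∑ μ : Fin 4, H y α μ * a μ β) * pd2 f α β y
      = ∑ α : Fin 4, ∑ β : Fin 4, H y α β * ∑ μ : Fin 4, a β μ * pd2 f α μ y := by
    simp only [Fin.sum_univ_four]
    ring
  simp only [commCoeff, sub_mul, add_mul, mul_add, mul_sub, Finset.sum_add_distrib,
    Finset.sum_sub_distrib, Finset.mul_sum (Finset.univ : Finset (Fin 4)) _ c] at hm ⊢
  rw [h1, h2]
  simp only [neg_mul, Finset.sum_neg_distrib, mul_assoc, mul_left_comm c] at hm ⊢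
  linear_combination hm

lemma lowerc_eq (y : Fin 4 → ℝ) (α : Fin 4) : lowerc y α = mink α α * y α := by
  by_cases h : α = 0
  · subst h; simp [lowerc, mink]
  · simp [lowerc, mink, h]

lemma ZV_cases (i : Fin 11) : (∃ μ, ZV i = dVF μ) ∨ (∃ μ ν, μ ≠ ν ∧ ZV i = omVF μ ν)
    ∨ ZV i = sVF := by
  fin_cases i
  · exact Or.inl ⟨0, rfl⟩
  · exact Or.inl ⟨1, rfl⟩
  · exact Or.inl ⟨2, rfl⟩
  · exact Or.inl ⟨3, rfl⟩
  · exact Or.inr (Or.inl ⟨0, 1, by decide, rfl⟩)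
  · exact Or.inr (Or.inl ⟨0, 2, by decide, rfl⟩)
  · exact Or.inr (Or.inl ⟨0, 3, by decide, rfl⟩)
  · exact Or.inr (Or.inl ⟨1, 2, by decide, rfl⟩)
  · exact Or.inr (Or.inl ⟨1, 3, by decide, rfl⟩)
  · exact Or.inr (Or.inl ⟨2, 3, by decide, rfl⟩)
  · exact Or.inr (Or.inr rfl)

lemma dVF_ne_sVF (μ : Fin 4) : dVF μ ≠ sVF := by
  intro h
  have := congrFun (congrFun h 0) μ
  simp [dVF, sVF] at this

lemma omVF_ne_sVF {μ ν : Fin 4} (h : μ ≠ ν) : omVF μ ν ≠ sVF := by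
  intro he
  have := congrFun (congrFun he (Pi.single μ 1)) μ
  simp [omVF, sVF, lowerc_eq, h, h.symm] at this

lemma exists_affVF {Zc : (Fin 4 → ℝ) → Fin 4 → ℝ} (hZ : ∃ i : Fin 11, Zc = ZV i) {c : ℝ}
    (hS : Zc = sVF → c = 2) (hN : Zc ≠ sVF → c = 0) :
    ∃ b a, Zc = affVF b a ∧ IsConformalKilling a c ∧ (∀ α β, |a α β| ≤ 1) ∧ |c| ≤ 2 := by
  obtain ⟨i, rfl⟩ := hZ
  rcases ZV_cases i with ⟨μ, h⟩ | ⟨μ, ν, hne, h⟩ | h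
  · have hc := hN (h ▸ dVF_ne_sVF μ)
    refine ⟨Pi.single μ 1, 0, ?_, ?_, ?_, ?_⟩
    · rw [h]; funext y ν; simp [affVF, dVF]
    · intro α β; simp [hc]
    · simp
    · simp [hc]
  · have hc := hN (h ▸ omVF_ne_sVF hne)
    refine ⟨0, fun α β => mink α μ * (if β = ν then 1 else 0)
      - mink α ν * (if β = μ then 1 else 0), ?_, ?_, ?_, ?_⟩
    · rw [h]
      funext y β
      have key : ∀ κ : Fin 4, ∑ α : Fin 4, y α * mink α κ = lowerc y κ := by
        intro κ
        rw [lowerc_eq, Finset.sum_eq_single κ]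
        · ring
        · intro α _ hα; simp [mink, hα]
        · simp
      simp only [affVF, omVF, mul_sub, Finset.sum_sub_distrib, ← mul_assoc, ← Finset.sum_mul, key]
      simp
    · intro α β
      subst hc
      revert μ ν α β
      simp only [mink]
      intro μ ν _ _ α β
      by_cases h1 : α = μ <;> by_cases h2 : α = ν <;> by_cases h3 : β = μ <;>
        by_cases h4 : β = ν <;> simp_all
    · intro α β
      simp only [mink]
      split_ifs <;> simp_all
    · simp [hc]
  · have hc := hS h
    refine ⟨0, fun α β => if α = β then 1 else 0, ?_, ?_, ?_, ?_⟩
    · rw [h]; funext y ν; simp [affVF, sVF]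
    · intro α β
      simp only [mink, hc]
      by_cases h1 : α = β
      · subst h1; simp only [if_true]; ring
      · simp [h1, Ne.symm h1]
    · intro α β
      dsimp only
      split_ifs <;> simp
    · simp [hc]

lemma abs_sum_mul_le {n : ℕ} {u v : Fin n → ℝ} {A B : ℝ} (hu : ∀ i, |u i| ≤ A)
    (hv : ∀ i, |v i| ≤ B) : |∑ i, u i * v i| ≤ n * (A * B) := by
  calc |∑ i, u i * v i| ≤ ∑ i, |u i * v i| := Finset.abs_sum_le_sum_abs _ _
    _ ≤ ∑ _i : Fin n, A * B := Finset.sum_le_sum fun i _ => by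
        rw [abs_mul]
        exact mul_le_mul (hu i) (hv i) (abs_nonneg _) ((abs_nonneg _).trans (hu i))
    _ = n * (A * B) := by simp

lemma abs_le_one_of_sum_sq {ω : Fin 3 → ℝ} (hω : ∑ i : Fin 3, ω i * ω i = 1) (i : Fin 3) :
    |ω i| ≤ 1 := by
  rw [← sq_le_one_iff_abs_le_one, ← hω, sq]
  exact Finset.single_le_sum (f := fun j => ω j * ω j) (fun j _ => mul_self_nonneg _)
    (Finset.mem_univ i)

lemma abs_vecLlow_le {ω : Fin 3 → ℝ} (hω : ∑ i : Fin 3, ω i * ω i = 1) (α : Fin 4) :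
    |vecLlow ω α| ≤ 1 := by
  have h := abs_le_one_of_sum_sq hω
  fin_cases α
  · simp [vecLlow]
  · exact h 0
  · exact h 1
  · exact h 2

/-- Completeness relation of an orthonormal frame. -/
lemma IsFrame.sum_eq {ω s₁ s₂ : Fin 3 → ℝ} (h : IsFrame ω s₁ s₂) (i j : Fin 3) :
    ω i * ω j + s₁ i * s₁ j + s₂ i * s₂ j = if i = j then 1 else 0 := by
  obtain ⟨h1, h2, h3, h4, h5, h6⟩ := h
  simp only [Fin.sum_univ_three] at h1 h2 h3 h4 h5 h6
  let O : Matrix (Fin 3) (Fin 3) ℝ := Matrix.of ![ω, s₁, s₂]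
  have hO : O * O.transpose = 1 := by
    ext a b
    fin_cases a <;> fin_cases b <;>
      simp [O, Matrix.mul_apply, Fin.sum_univ_three] <;> linarith
  have hO' : (O.transpose * O) i j = (1 : Matrix (Fin 3) (Fin 3) ℝ) i j := by
    rw [mul_eq_one_comm.mp hO]
  simpa [O, Matrix.mul_apply, Fin.sum_univ_three, Matrix.one_apply] using hO'

lemma contract_le_normLT {a : Fin 4 → Fin 4 → ℝ} {c : ℝ} (ha : IsConformalKilling a c)
    (ha1 : ∀ α β, |a α β| ≤ 1) {ω s₁ s₂ : Fin 3 → ℝ} (hF : IsFrame ω s₁ s₂)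
    {h : Fin 4 → Fin 4 → ℝ} :
    |con2 h (vecLlow ω) (fun α => ∑ μ : Fin 4, a α μ * vecLlow ω μ)|
      ≤ 12 * normLT h ω s₁ s₂ := by
  set w : Fin 4 → ℝ := fun α => ∑ μ : Fin 4, a α μ * vecLlow ω μ with hw
  have hL := abs_vecLlow_le hF.1
  have hw4 : ∀ α, |w α| ≤ 4 := fun α => by
    have := abs_sum_mul_le (ha1 α) hL
    norm_num at this
    exact this
  have hs1 := abs_le_one_of_sum_sq hF.2.1
  have hs2 := abs_le_one_of_sum_sq hF.2.2.1
  have hω1 : ω 0 * ω 0 + ω 1 * ω 1 + ω 2 * ω 2 = 1 := by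
    have := hF.1; rwa [Fin.sum_univ_three] at this
  have hnull : w 0 + w 1 * ω 0 + w 2 * ω 1 + w 3 * ω 2 = 0 := by
    have e00 := ha 0 0
    have e11 := ha 1 1
    have e22 := ha 2 2
    have e33 := ha 3 3
    have e01 := ha 0 1
    have e02 := ha 0 2
    have e03 := ha 0 3
    have e12 := ha 1 2
    have e13 := ha 1 3
    have e23 := ha 2 3
    simp [mink] at e00 e11 e22 e33 e01 e02 e03 e12 e13 e23
    simp [hw, Fin.sum_univ_four, vecLlow]
    linear_combination (1 / 2) * e00 + (1 / 2) * e11 * ω 0 * ω 0 + (1 / 2) * e22 * ω 1 * ω 1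
      + (1 / 2) * e33 * ω 2 * ω 2 - e01 * ω 0 - e02 * ω 1 - e03 * ω 2 + e12 * ω 0 * ω 1
      + e13 * ω 0 * ω 2 + e23 * ω 1 * ω 2 + c / 2 * hω1
  have hdec : ∀ α, w α = -w 0 * vecLlow ω α
      + (∑ i : Fin 3, w i.succ * s₁ i) * spat s₁ α
      + (∑ i : Fin 3, w i.succ * s₂ i) * spat s₂ α := by
    have c := hF.sum_eq
    intro α
    fin_cases α
    · simp [vecLlow, spat]
    · have c0 := c 0 0
      have c1 := c 1 0
      have c2 := c 2 0
      simp at c0 c1 c2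
      simp [vecLlow, spat, Fin.sum_univ_three]
      linear_combination -w 1 * c0 - w 2 * c1 - w 3 * c2 + ω 0 * hnull
    · have c0 := c 0 1
      have c1 := c 1 1
      have c2 := c 2 1
      simp at c0 c1 c2
      simp [vecLlow, spat, Fin.sum_univ_three]
      linear_combination -w 1 * c0 - w 2 * c1 - w 3 * c2 + ω 1 * hnull
    · have c0 := c 0 2
      have c1 := c 1 2
      have c2 := c 2 2
      simp at c0 c1 c2
      simp [vecLlow, spat, Fin.sum_univ_three]
      linear_combination -w 1 * c0 - w 2 * c1 - w 3 * c2 + ω 2 * hnull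
  have hA : |∑ i : Fin 3, w i.succ * s₁ i| ≤ 12 := by
    have := abs_sum_mul_le (u := fun i : Fin 3 => w i.succ) (fun i => hw4 _) hs1
    norm_num at this
    exact this
  have hB : |∑ i : Fin 3, w i.succ * s₂ i| ≤ 12 := by
    have := abs_sum_mul_le (u := fun i : Fin 3 => w i.succ) (fun i => hw4 _) hs2
    norm_num at this
    exact this
  have hC : |-w 0| ≤ 12 := by rw [abs_neg]; linarith [hw4 0]
  generalize (∑ i : Fin 3, w i.succ * s₁ i) = A at hdec hA
  generalize (∑ i : Fin 3, w i.succ * s₂ i) = B at hdec hB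
  generalize -w 0 = D at hdec hC
  have hcon : con2 h (vecLlow ω) w = D * con2 h (vecLlow ω) (vecLlow ω)
      + A * con2 h (vecLlow ω) (spat s₁) + B * con2 h (vecLlow ω) (spat s₂) := by
    simp only [con2, Finset.mul_sum, ← Finset.sum_add_distrib]
    refine Finset.sum_congr rfl fun α _ => Finset.sum_congr rfl fun β _ => ?_
    rw [hdec β]
    ring
  rw [hcon, normLT]
  calc _ ≤ |D * con2 h (vecLlow ω) (vecLlow ω)| + |A * con2 h (vecLlow ω) (spat s₁)|
        + |B * con2 h (vecLlow ω) (spat s₂)| := abs_add_three _ _ _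
    _ ≤ 12 * |con2 h (vecLlow ω) (vecLlow ω)| + 12 * |con2 h (vecLlow ω) (spat s₁)|
        + 12 * |con2 h (vecLlow ω) (spat s₂)| := by
        simp only [abs_mul]
        gcongr
    _ = _ := by ring

lemma abs_con2_commCoeff_le {a : Fin 4 → Fin 4 → ℝ} {c : ℝ} (ha : IsConformalKilling a c)
    (ha1 : ∀ α β, |a α β| ≤ 1) (hc : |c| ≤ 2) {ω s₁ s₂ : Fin 3 → ℝ} (hF : IsFrame ω s₁ s₂)
    {k h : Fin 4 → Fin 4 → ℝ} (hs : ∀ α β, h α β = h β α) :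
    |con2 (commCoeff k h a c) (vecLlow ω) (vecLlow ω)|
      ≤ |con2 k (vecLlow ω) (vecLlow ω)| + 26 * normLT h ω s₁ s₂ := by
  have hw := contract_le_normLT ha ha1 hF (h := h)
  have hLL : |con2 h (vecLlow ω) (vecLlow ω)| ≤ normLT h ω s₁ s₂ := by
    rw [normLT, add_assoc]
    exact le_add_of_nonneg_right (by positivity)
  have heq : con2 (commCoeff k h a c) (vecLlow ω) (vecLlow ω)
      = -con2 k (vecLlow ω) (vecLlow ω)
        + 2 * con2 h (vecLlow ω) (fun α => ∑ μ : Fin 4, a α μ * vecLlow ω μ)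
        - c * con2 h (vecLlow ω) (vecLlow ω) := by
    generalize vecLlow ω = l
    simp only [con2, commCoeff, Fin.sum_univ_four,
      hs 1 0, hs 2 0, hs 3 0, hs 2 1, hs 3 1, hs 3 2]
    ring
  have hcLL : |c * con2 h (vecLlow ω) (vecLlow ω)| ≤ 2 * normLT h ω s₁ s₂ := by
    rw [abs_mul]
    exact mul_le_mul hc hLL (abs_nonneg _) (by norm_num)
  rw [heq]
  rw [abs_le] at hw hcLL ⊢
  have h1 := le_abs_self (con2 k (vecLlow ω) (vecLlow ω))
  have h2 := neg_abs_le (con2 k (vecLlow ω) (vecLlow ω))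
  constructor <;> linarith [hw.1, hw.2, hcLL.1, hcLL.2]

lemma abs_commCoeff_le {a : Fin 4 → Fin 4 → ℝ} {c : ℝ} (ha1 : ∀ α β, |a α β| ≤ 1)
    (hc : |c| ≤ 2) (k h : Fin 4 → Fin 4 → ℝ) (α β : Fin 4) :
    |commCoeff k h a c α β| ≤ 10 * (tnorm h + tnorm k) := by
  have hk := abs_le_tnorm k α β
  have hh := abs_le_tnorm h
  have h1 := abs_sum_mul_le (u := fun μ => h μ β) (v := fun μ => a μ α)
    (fun μ => hh μ β) (fun μ => ha1 μ α)
  have h2 := abs_sum_mul_le (u := fun μ => h α μ) (v := fun μ => a μ β)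
    (fun μ => hh α μ) (fun μ => ha1 μ β)
  have h3 : |c * h α β| ≤ 2 * tnorm h := by
    rw [abs_mul]
    exact mul_le_mul hc (hh α β) (abs_nonneg _) (by norm_num)
  have hk0 := (abs_nonneg _).trans hk
  push_cast at h1 h2
  unfold commCoeff
  rw [abs_le] at hk h1 h2 h3 ⊢
  constructor <;> linarith [hk.1, hk.2, h1.1, h1.2, h2.1, h2.2, h3.1, h3.2]

/-- A symmetric matrix contracted with `K` is controlled by its double transversal component,
weighted by `K_{LL}`, and its tangential components. -/
lemma abs_sum_mul_symm_le {K M : Fin 4 → Fin 4 → ℝ} (hM : ∀ α β, M α β = M β α)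
    {l : Fin 4 → ℝ} (hl : ∀ α, |l α| ≤ 1) {κ A B : ℝ} (hK : ∀ α β, |K α β| ≤ κ)
    (hA : ∀ β, |∑ α : Fin 4, l α * M α β / 2| ≤ A)
    (hB : ∀ α β, |M α β - l α * (∑ γ : Fin 4, l γ * M γ β / 2)| ≤ B) :
    |∑ α : Fin 4, ∑ β : Fin 4, K α β * M α β|
      ≤ |con2 K l l| * (2 * A) + 48 * κ * B := by
  set Q : Fin 4 → ℝ := fun β => ∑ α : Fin 4, l α * M α β / 2 with hQ
  set T : Fin 4 → Fin 4 → ℝ := fun α β => M α β - l α * Q β with hT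
  set N : ℝ := (∑ β : Fin 4, l β * Q β) / 2 with hN
  have hB0 : 0 ≤ B := (abs_nonneg _).trans (hB 0 0)
  have hκ0 : 0 ≤ κ := (abs_nonneg _).trans (hK 0 0)
  have hA0 : 0 ≤ A := (abs_nonneg _).trans (hA 0)
  have hN2 : |N| ≤ 2 * A := by
    have := abs_sum_mul_le hl hA
    rw [hN, abs_div, abs_two]
    push_cast at this
    linarith
  set P : Fin 4 → ℝ := fun β => (∑ γ : Fin 4, T β γ * l γ) / 2 with hP
  have hPB : ∀ β, |P β| ≤ 2 * B := by
    intro β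
    have := abs_sum_mul_le (hB β) hl
    rw [hP, abs_div, abs_two]
    push_cast at this
    linarith
  have hPe : ∀ β, P β = Q β - l β * N := by
    intro β
    simp only [hP, hT, hN, hQ, Fin.sum_univ_four, hM 0 β, hM 1 β, hM 2 β, hM 3 β]
    ring
  have hMe : ∀ α β, M α β = l α * l β * N + (l α * P β + T α β) := by
    intro α β
    rw [hPe]
    simp only [hT]
    ring
  have hsum : ∑ α : Fin 4, ∑ β : Fin 4, K α β * M α β
      = con2 K l l * N + ∑ α : Fin 4, ∑ β : Fin 4, K α β * (l α * P β + T α β) := by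
    simp only [con2, Finset.sum_mul, ← Finset.sum_add_distrib]
    refine Finset.sum_congr rfl fun α _ => Finset.sum_congr rfl fun β _ => ?_
    nth_rewrite 1 [hMe α β]
    ring
  have hR : |∑ α : Fin 4, ∑ β : Fin 4, K α β * (l α * P β + T α β)| ≤ 48 * κ * B := by
    have h3 : ∀ α β, |l α * P β + T α β| ≤ 3 * B := by
      intro α β
      have h1 : |l α * P β| ≤ 1 * (2 * B) := by
        rw [abs_mul]
        exact mul_le_mul (hl α) (hPB β) (abs_nonneg _) zero_le_one
      have h2 : |T α β| ≤ B := hB α β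
      linarith [abs_add_le (l α * P β) (T α β)]
    calc _ ≤ ∑ α : Fin 4, |∑ β : Fin 4, K α β * (l α * P β + T α β)| :=
          Finset.abs_sum_le_sum_abs _ _
      _ ≤ ∑ _α : Fin 4, ((4 : ℕ) : ℝ) * (κ * (3 * B)) := Finset.sum_le_sum fun α _ =>
          abs_sum_mul_le (hK α) (h3 α)
      _ = 48 * κ * B := by simp; ring
  rw [hsum]
  calc _ ≤ |con2 K l l * N| + _ := abs_add_le _ _
    _ ≤ _ := by
      rw [abs_mul]
      gcongr

/-- The fields in `𝒵` control transversal derivatives with weight `1 + |q|` and tangential ones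
with weight `1 + t + |q|`. -/
lemma weighted_derivative_bounds {y : Fin 4 → ℝ} (ht : 0 ≤ y 0)
    (hω : ∑ i : Fin 3, uom y i * uom y i = 1) {p : Fin 4 → ℝ} {D : ℝ}
    (hD : ∀ i, |∑ μ : Fin 4, ZV i y μ * p μ| ≤ D) :
    (1 + |qq y|) * |∑ γ : Fin 4, vecLlow (uom y) γ * p γ / 2| ≤ 8 * D ∧
    ∀ α, (1 + y 0 + |qq y|)
      * |p α - vecLlow (uom y) α * ∑ γ : Fin 4, vecLlow (uom y) γ * p γ / 2| ≤ 40 * D := by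
  have hr0 : 0 ≤ rad y := Real.sqrt_nonneg _
  have hr : rad y ≠ 0 := by
    intro h
    simp [uom, h] at hω
  have hy : ∀ i : Fin 3, y i.succ = rad y * uom y i := fun i => by
    simp only [uom, sp]
    field_simp
  have hu := abs_le_one_of_sum_sq hω
  have hq : |qq y| ≤ rad y + y 0 := by
    rw [qq, abs_le]
    constructor <;> linarith
  have hqq : |qq y| = |y 0 - rad y| := abs_sub_comm _ _
  have hp : ∀ α, |p α| ≤ D := fun α => by
    fin_cases α
    · simpa [ZV, dVF, Pi.single_apply] using hD 0
    · simpa [ZV, dVF, Pi.single_apply] using hD 1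
    · simpa [ZV, dVF, Pi.single_apply] using hD 2
    · simpa [ZV, dVF, Pi.single_apply] using hD 3
  have hD0 : 0 ≤ D := (abs_nonneg _).trans (hp 0)
  have y1 : y 1 = rad y * uom y 0 := hy 0
  have y2 : y 2 = rad y * uom y 1 := hy 1
  have y3 : y 3 = rad y * uom y 2 := hy 2
  have b1 := hD 4
  have b2 := hD 5
  have b3 := hD 6
  have r12 := hD 7
  have r13 := hD 8
  have r23 := hD 9
  have sc := hD 10
  simp only [ZV, omVF, sVF, lowerc, Fin.sum_univ_four, Matrix.cons_val] at b1 b2 b3 r12 r13 r23 sc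
  simp only [y1, y2, y3] at b1 b2 b3 r12 r13 r23 sc
  simp at b1 b2 b3 r12 r13 r23
  rw [Fin.sum_univ_three] at hω
  have key : ∀ {u b E : ℝ}, |u| ≤ 1 → |b| ≤ E → |u * b| ≤ E := fun {u b E} h1 h2 => by
    rw [abs_mul]
    exact (mul_le_of_le_one_left (abs_nonneg _) h1).trans h2
  have hQ : ∑ γ : Fin 4, vecLlow (uom y) γ * p γ / 2
      = (uom y 0 * p 1 + uom y 1 * p 2 + uom y 2 * p 3 - p 0) / 2 := by
    simp only [Fin.sum_univ_four, vecLlow, Matrix.cons_val]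
    ring
  have u0 := hu 0
  have u1 := hu 1
  have u2 := hu 2
  have l0 : vecLlow (uom y) 0 = -1 := rfl
  have l1 : vecLlow (uom y) 1 = uom y 0 := rfl
  have l2 : vecLlow (uom y) 2 = uom y 1 := rfl
  have l3 : vecLlow (uom y) 3 = uom y 2 := rfl
  rw [hQ]
  generalize vecLlow (uom y) = l at *
  clear hQ hy hu hr hD y1 y2 y3
  generalize rad y = r at *
  generalize y 0 = t at *
  generalize uom y 0 = w0 at *
  generalize uom y 1 = w1 at *
  generalize uom y 2 = w2 at *
  set b₁ := -(r * w0 * p 0) + -(t * p 1) with hb1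
  set b₂ := -(r * w1 * p 0) + -(t * p 2) with hb2
  set b₃ := -(r * w2 * p 0) + -(t * p 3) with hb3
  set c₁₂ := -(r * w1 * p 1) + r * w0 * p 2 with hc12
  set c₁₃ := -(r * w2 * p 1) + r * w0 * p 3 with hc13
  set c₂₃ := -(r * w2 * p 2) + r * w1 * p 3 with hc23
  set W := w0 * b₁ + w1 * b₂ + w2 * b₃ with hWd
  have hW : |W| ≤ 3 * D := by
    have := abs_add_three (w0 * b₁) (w1 * b₂) (w2 * b₃)
    linarith [key u0 b1, key u1 b2, key u2 b3]
  set Q := (w0 * p 1 + w1 * p 2 + w2 * p 3 - p 0) / 2 with hQd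
  have hQ2 : |Q| ≤ 2 * D := by
    have h1 := abs_le.mp (key u0 (hp 1))
    have h2 := abs_le.mp (key u1 (hp 2))
    have h3 := abs_le.mp (key u2 (hp 3))
    have h4 := abs_le.mp (hp 0)
    rw [hQd, abs_le]
    constructor <;> linarith [h1.1, h1.2, h2.1, h2.2, h3.1, h3.2, h4.1, h4.2]
  set s := t * p 0 + r * w0 * p 1 + r * w1 * p 2 + r * w2 * p 3 with hs
  have hqQ : |t - r| * |Q| ≤ 2 * D := by
    have : (t - r) * Q = -(s + W) / 2 := by
      rw [hQd, hs, hWd, hb1, hb2, hb3]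
      linear_combination -(r * p 0 / 2) * hω
    rw [← abs_mul, this, abs_le]
    have h1 := abs_le.mp hW
    have h2 := abs_le.mp sc
    constructor <;> linarith [h1.1, h1.2, h2.1, h2.2]
  have hT0 : |(t + r) * (p 0 + Q)| ≤ 2 * D := by
    have : (t + r) * (p 0 + Q) = (s - W) / 2 := by
      rw [hQd, hs, hWd, hb1, hb2, hb3]
      linear_combination -(r * p 0 / 2) * hω
    rw [this, abs_le]
    have h1 := abs_le.mp hW
    have h2 := abs_le.mp sc
    constructor <;> linarith [h1.1, h1.2, h2.1, h2.2]
  have hfin : ∀ T : ℝ, |T| ≤ 3 * D → |(t + r) * T| ≤ 8 * D →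
      (1 + t + |qq y|) * |T| ≤ 40 * D := by
    intro T h1 h2
    rw [abs_mul, abs_of_nonneg (add_nonneg ht hr0)] at h2
    have h3 : (1 + t + |qq y|) * |T| ≤ (1 + 2 * (t + r)) * |T| :=
      mul_le_mul_of_nonneg_right (by linarith) (abs_nonneg _)
    nlinarith
  have htan : ∀ {w B c c' P : ℝ}, |w| ≤ 1 → |B| ≤ D → |c| ≤ D → |c'| ≤ D → |P| ≤ D →
      (t + r) * (P - w * Q) = -B + w * W + c + c' + w * ((t + r) * (p 0 + Q)) →
      (1 + t + |qq y|) * |P - w * Q| ≤ 40 * D := by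
    intro w B c c' P hw hB hc hc' hP he
    apply hfin
    · have h1 := abs_le.mp (key hw hQ2)
      have h2 := abs_le.mp hP
      rw [abs_le]
      constructor <;> linarith [h1.1, h1.2, h2.1, h2.2]
    · rw [he]
      have h1 := abs_le.mp (key hw hW)
      have h2 := abs_le.mp (key hw hT0)
      have h3 := abs_le.mp hB
      have h4 := abs_le.mp hc
      have h5 := abs_le.mp hc'
      rw [abs_le]
      constructor <;> linarith [h1.1, h1.2, h2.1, h2.2, h3.1, h3.2, h4.1, h4.2, h5.1, h5.2]
  have hneg : ∀ {a : ℝ}, |a| ≤ D → |-a| ≤ D := fun h => by rwa [abs_neg]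
  refine ⟨by rw [hqq]; linarith [add_mul 1 |t - r| |Q|], fun α => ?_⟩
  fin_cases α
  · show (1 + t + |qq y|) * |p 0 - l 0 * Q| ≤ 40 * D
    rw [l0, show p 0 - -1 * Q = p 0 + Q by ring]
    refine hfin _ ?_ (by linarith)
    linarith [abs_add_le (p 0) Q, hp 0]
  · show (1 + t + |qq y|) * |p 1 - l 1 * Q| ≤ 40 * D
    rw [l1]
    refine htan u0 b1 (hneg (key u1 r12)) (hneg (key u2 r13)) (hp 1) ?_
    rw [hQd, hWd, hb1, hb2, hb3, hc12, hc13]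
    linear_combination (w0 * r * p 0 - r * p 1) * hω
  · show (1 + t + |qq y|) * |p 2 - l 2 * Q| ≤ 40 * D
    rw [l2]
    refine htan u1 b2 (key u0 r12) (hneg (key u2 r23)) (hp 2) ?_
    rw [hQd, hWd, hb1, hb2, hb3, hc12, hc23]
    linear_combination (w1 * r * p 0 - r * p 2) * hω
  · show (1 + t + |qq y|) * |p 3 - l 3 * Q| ≤ 40 * D
    rw [l3]
    refine htan u2 b3 (key u0 r13) (key u1 r23) (hp 3) ?_
    rw [hQd, hWd, hb1, hb2, hb3, hc13, hc23]
    linear_combination (w2 * r * p 0 - r * p 3) * hω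

lemma exists_affVF_ZV (i : Fin 11) :
    ∃ b a, ZV i = affVF b a ∧ ∀ α β, |a α β| ≤ 1 := by
  by_cases h : ZV i = sVF
  · obtain ⟨b, a, h1, -, h2, -⟩ := exists_affVF ⟨i, rfl⟩ (c := 2) (fun _ => rfl)
      (fun h' => absurd h h')
    exact ⟨b, a, h1, h2⟩
  · obtain ⟨b, a, h1, -, h2, -⟩ := exists_affVF ⟨i, rfl⟩ (c := 0) (fun h' => absurd h' h)
      (fun _ => rfl)
    exact ⟨b, a, h1, h2⟩

lemma abs_Zap_pd_le {f : (Fin 4 → ℝ) → ℝ} (hf : ContDiff ℝ (⊤ : ℕ∞) f) (y : Fin 4 → ℝ)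
    (β : Fin 4) (i : Fin 11) :
    |Zap (ZV i) (pd f β) y| ≤ 4 * (dnorm f y + ∑ j : Fin 11, dnorm (Zap (ZV j) f) y) := by
  obtain ⟨b, a, hZ, ha⟩ := exists_affVF_ZV i
  have h1 := abs_pd_le_dnorm (Zap (ZV i) f) β y
  have h2 := abs_sum_mul_le (ha β) fun μ => abs_pd_le_dnorm f μ y
  have h3 : dnorm (Zap (ZV i) f) y ≤ ∑ j : Fin 11, dnorm (Zap (ZV j) f) y :=
    Finset.single_le_sum (f := fun j => dnorm (Zap (ZV j) f) y)
      (fun _ _ => Real.sqrt_nonneg _) (Finset.mem_univ i)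
  have h4 : pd (Zap (ZV i) f) β y
      = Zap (ZV i) (pd f β) y + ∑ μ : Fin 4, a β μ * pd f μ y := by
    rw [hZ, pd_Zap b a hf]
  have h5 : 0 ≤ dnorm (Zap (ZV i) f) y := Real.sqrt_nonneg _
  push_cast at h2
  rw [abs_le] at h1 h2 ⊢
  constructor <;> linarith [h1.1, h1.2, h2.1, h2.2]

/-- Corollary 7.6, eq. (7.13): commutator estimate for the reduced wave operator. -/
theorem commutator_estimate_reduced_wave :
    ∃ C : ℝ, 0 < C ∧
      ∀ (H : (Fin 4 → ℝ) → Fin 4 → Fin 4 → ℝ),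
        (∀ α β, ContDiff ℝ (⊤ : ℕ∞) (fun y => H y α β)) →
        (∀ y α β, H y α β = H y β α) →
      ∀ (Zc : (Fin 4 → ℝ) → Fin 4 → ℝ), (∃ i : Fin 11, Zc = ZV i) →
      ∀ cZ : ℝ, (Zc = sVF → cZ = 2) → (Zc ≠ sVF → cZ = 0) →
      ∀ (φ : (Fin 4 → ℝ) → ℝ), ContDiff ℝ (⊤ : ℕ∞) φ →
      ∀ y : Fin 4 → ℝ, 0 ≤ y 0 → sp y ≠ 0 →
      ∀ s₁ s₂ : Fin 3 → ℝ, IsFrame (uom y) s₁ s₂ →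
        |boxg H (Zap Zc φ) y - (Zap Zc (boxg H φ) y + cZ * boxg H φ y)|
          ≤ C * ((tnorm (H y) + tnorm (fun α β => Zap Zc (fun z => H z α β) y))
                    / (1 + y 0 + |qq y|)
                + (|con2 (fun α β => Zap Zc (fun z => H z α β) y)
                      (vecLlow (uom y)) (vecLlow (uom y))|
                    + normLT (H y) (uom y) s₁ s₂) / (1 + |qq y|))
              * (dnorm φ y + ∑ i : Fin 11, dnorm (Zap (ZV i) φ) y) := by
  refine ⟨100000, by norm_num, ?_⟩
  intro H hH hsymm Zc hZ c hS hN φ hφ y ht _ s₁ s₂ hF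
  obtain ⟨b, a, rfl, ha, ha1, hc⟩ := exists_affVF hZ hS hN
  rw [boxg_commutator ha hH hφ]
  set k : Fin 4 → Fin 4 → ℝ := fun α β => Zap (affVF b a) (fun z => H z α β) y
  set E := dnorm φ y + ∑ i : Fin 11, dnorm (Zap (ZV i) φ) y
  have hE : 0 ≤ E := add_nonneg (Real.sqrt_nonneg _)
    (Finset.sum_nonneg fun _ _ => Real.sqrt_nonneg _)
  have hw : 0 < 1 + |qq y| := by positivity
  have hw' : 0 < 1 + y 0 + |qq y| := by positivity
  have hder := fun β => weighted_derivative_bounds ht hF.1 (p := fun α => pd2 φ α β y)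
    fun i => abs_Zap_pd_le hφ y β i
  have hA : ∀ β, |∑ α : Fin 4, vecLlow (uom y) α * pd2 φ α β y / 2|
      ≤ 32 * E / (1 + |qq y|) := fun β => by
    rw [le_div_iff₀' hw]
    linarith [(hder β).1]
  have hB : ∀ α β, |pd2 φ α β y
      - vecLlow (uom y) α * ∑ γ : Fin 4, vecLlow (uom y) γ * pd2 φ γ β y / 2|
      ≤ 160 * E / (1 + y 0 + |qq y|) := fun α β => by
    rw [le_div_iff₀' hw']
    linarith [(hder β).2 α]
  have hmain := abs_sum_mul_symm_le (M := fun α β => pd2 φ α β y)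
    (fun α β => pd2_symm hφ α β y) (abs_vecLlow_le hF.1)
    (abs_commCoeff_le ha1 hc k (H y)) hA hB
  have hLL := abs_con2_commCoeff_le ha ha1 hc hF (k := k) (hsymm y)
  set X := |con2 k (vecLlow (uom y)) (vecLlow (uom y))|
  have hX : 0 ≤ X := abs_nonneg _
  have hT : 0 ≤ tnorm (H y) + tnorm k :=
    add_nonneg (Real.sqrt_nonneg _) (Real.sqrt_nonneg _)
  have hN0 : 0 ≤ normLT (H y) (uom y) s₁ s₂ := by
    unfold normLT
    positivity
  calc _ ≤ _ := hmain
    _ ≤ (26 * (X + normLT (H y) (uom y) s₁ s₂)) * (2 * (32 * E / (1 + |qq y|)))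
        + 48 * (10 * (tnorm (H y) + tnorm k)) * (160 * E / (1 + y 0 + |qq y|)) := by
      gcongr
      linarith
    _ = (76800 * ((tnorm (H y) + tnorm k) / (1 + y 0 + |qq y|))
        + 1664 * ((X + normLT (H y) (uom y) s₁ s₂) / (1 + |qq y|))) * E := by
      ring
    _ ≤ _ := by
      have h1 : 0 ≤ (tnorm (H y) + tnorm k) / (1 + y 0 + |qq y|) := by positivity
      have h2 : 0 ≤ (X + normLT (H y) (uom y) s₁ s₂) / (1 + |qq y|) := by positivity
      gcongr
      linarith
end LindbladRodnianski
end
end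

section
/- Weighted Poincaré inequality with boundary term (Lemma 9.1): for every γ > −1/2 with γ ≠ 1/2 there is a constant C = C(γ) such that for every t > 0 and every smooth function f on ℝ³ for which the left-hand side is finite, ∫_{ℝ³} |f(x)|²/(1+|t−r|)^{2+2γ} dx ≤ C ∫_{S_{t+1}} |f|² dS + C ∫_{ℝ³} |∂_r f(x)|²/(1+|t−r|)^{2γ} dx, where r = |x|, ∂_r f = (x/|x|)·∇f, and S_{t+1} is the sphere of radius t+1 centered at the origin with its surface measure dS. -/
open scoped BigOperators ENNReal
open MeasureTheory Metric

noncomputable section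

namespace LindbladRodnianski

/-- the radial derivative ∂_r f = (x/|x|)·∇f -/
def radDeriv (f : EuclideanSpace ℝ (Fin 3) → ℝ) (x : EuclideanSpace ℝ (Fin 3)) : ℝ :=
  fderiv ℝ f x (‖x‖⁻¹ • x)

/-- integral of `g` over the sphere of radius `R` (centered at the origin) with respect to
the standard surface measure, written via the surface measure `volume.toSphere` of the
unit sphere. -/
def sphereLintegral (R : ℝ) (g : EuclideanSpace ℝ (Fin 3) → ℝ≥0∞) : ℝ≥0∞ :=
  ENNReal.ofReal (R ^ 2) *
    ∫⁻ ω : sphere (0 : EuclideanSpace ℝ (Fin 3)) 1,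
      g (R • (ω : EuclideanSpace ℝ (Fin 3)))
      ∂((volume : Measure (EuclideanSpace ℝ (Fin 3))).toSphere)

open Set Filter

theorem quadratic_form_nonneg {P Q b : ℝ} (hP : 0 ≤ P) (hQ : 0 ≤ Q) (hb : b ^ 2 ≤ P * Q)
    (x y : ℝ) : 0 ≤ P * x ^ 2 + 2 * b * x * y + Q * y ^ 2 := by
  rcases hP.eq_or_lt with rfl | hP
  · have : b = 0 := by nlinarith
    subst this
    nlinarith [mul_nonneg hQ (sq_nonneg y)]
  · refine nonneg_of_mul_nonneg_right (a := P) ?_ hP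
    nlinarith [sq_nonneg (P * x + b * y), mul_nonneg (sub_nonneg.2 hb) (sq_nonneg y)]

/-- A one-dimensional Hardy inequality: integrate `(Ψ u²)'` and absorb the cross term. -/
theorem integral_mul_sq_le {a b c K : ℝ} (hab : a ≤ b) (hc : 0 < c) (hK : 0 ≤ K)
    {u u' Ψ Ψ' w v : ℝ → ℝ}
    (hu : ∀ x ∈ Icc a b, HasDerivAt u (u' x) x) (hu' : ContinuousOn u' (Icc a b))
    (hΨ : ∀ x ∈ Icc a b, HasDerivAt Ψ (Ψ' x) x) (hΨ' : ContinuousOn Ψ' (Icc a b))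
    (hw : ContinuousOn w (Icc a b)) (hv : ContinuousOn v (Icc a b))
    (hw0 : ∀ x ∈ Icc a b, 0 ≤ w x) (hv0 : ∀ x ∈ Icc a b, 0 ≤ v x)
    (hwΨ : ∀ x ∈ Icc a b, c * w x ≤ Ψ' x)
    (hΨK : ∀ x ∈ Icc a b, Ψ x ^ 2 ≤ K * w x * v x) :
    ∫ x in a..b, w x * u x ^ 2 ≤
      2 / c * (Ψ b * u b ^ 2 - Ψ a * u a ^ 2) + 4 * K / c ^ 2 * ∫ x in a..b, v x * u' x ^ 2 := by
  have hcu : ContinuousOn u (Icc a b) := fun x hx => (hu x hx).continuousAt.continuousWithinAt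
  have hcΨ : ContinuousOn Ψ (Icc a b) := fun x hx => (hΨ x hx).continuousAt.continuousWithinAt
  have hint {g : ℝ → ℝ} (hg : ContinuousOn g (Icc a b)) : IntervalIntegrable g volume a b :=
    ContinuousOn.intervalIntegrable (by rwa [uIcc_of_le hab])
  have hftc : ∫ x in a..b, (Ψ' x * u x ^ 2 + Ψ x * (2 * u x * u' x)) =
      Ψ b * u b ^ 2 - Ψ a * u a ^ 2 := by
    refine intervalIntegral.integral_eq_sub_of_hasDerivAt (f := fun x => Ψ x * u x ^ 2)
      (fun x hx => ?_) (hint (by fun_prop))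
    rw [uIcc_of_le hab] at hx
    exact ((hΨ x hx).mul ((hu x hx).pow 2)).congr_deriv (by simp)
  rw [← hftc, ← intervalIntegral.integral_const_mul, ← intervalIntegral.integral_const_mul,
    ← intervalIntegral.integral_add (hint (by fun_prop)) (hint (by fun_prop))]
  refine intervalIntegral.integral_mono_on hab (hint (by fun_prop)) (hint (by fun_prop))
    fun x hx => ?_
  have hq := quadratic_form_nonneg (P := c / 2 * w x) (Q := 2 * K / c * v x) (b := Ψ x)
    (mul_nonneg (by positivity) (hw0 x hx)) (mul_nonneg (by positivity) (hv0 x hx))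
    (by convert hΨK x hx using 1; field_simp) (u x) (u' x)
  have h1 := mul_le_mul_of_nonneg_right (hwΨ x hx) (sq_nonneg (u x))
  have h2 : 0 ≤ 2 / c * ((Ψ' x * u x ^ 2 - c * w x * u x ^ 2) +
      (c / 2 * w x * u x ^ 2 + 2 * Ψ x * u x * u' x + 2 * K / c * v x * u' x ^ 2)) :=
    mul_nonneg (by positivity) (add_nonneg (sub_nonneg.2 h1) hq)
  rw [← sub_nonneg]
  convert h2 using 1
  field_simp
  ring

theorem lintegral_mul_sq_le {a b c K : ℝ} (hab : a ≤ b) (hc : 0 < c) (hK : 0 ≤ K)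
    {u u' Ψ Ψ' w v : ℝ → ℝ}
    (hu : ∀ x ∈ Icc a b, HasDerivAt u (u' x) x) (hu' : ContinuousOn u' (Icc a b))
    (hΨ : ∀ x ∈ Icc a b, HasDerivAt Ψ (Ψ' x) x) (hΨ' : ContinuousOn Ψ' (Icc a b))
    (hw : ContinuousOn w (Icc a b)) (hv : ContinuousOn v (Icc a b))
    (hw0 : ∀ x ∈ Icc a b, 0 ≤ w x) (hv0 : ∀ x ∈ Icc a b, 0 ≤ v x)
    (hwΨ : ∀ x ∈ Icc a b, c * w x ≤ Ψ' x)
    (hΨK : ∀ x ∈ Icc a b, Ψ x ^ 2 ≤ K * w x * v x) :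
    ∫⁻ x in Ioc a b, ENNReal.ofReal (w x * u x ^ 2) ≤
      ENNReal.ofReal (2 / c * (Ψ b * u b ^ 2 - Ψ a * u a ^ 2)) +
        ENNReal.ofReal (4 * K / c ^ 2) * ∫⁻ x in Ioc a b, ENNReal.ofReal (v x * u' x ^ 2) := by
  have hcu : ContinuousOn u (Icc a b) := fun x hx => (hu x hx).continuousAt.continuousWithinAt
  have hint {g h : ℝ → ℝ} (hg : ContinuousOn g (Icc a b)) (hh : ContinuousOn h (Icc a b))
      (hg0 : ∀ x ∈ Icc a b, 0 ≤ g x) : ∫⁻ x in Ioc a b, ENNReal.ofReal (g x * h x ^ 2) =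
        ENNReal.ofReal (∫ x in a..b, g x * h x ^ 2) := by
    rw [intervalIntegral.integral_of_le hab, ofReal_integral_eq_lintegral_ofReal]
    · exact (((hg.mul (hh.pow 2)).integrableOn_Icc).mono_set Ioc_subset_Icc_self)
    · filter_upwards [ae_restrict_mem measurableSet_Ioc] with x hx
      exact mul_nonneg (hg0 x (Ioc_subset_Icc_self hx)) (sq_nonneg _)
  rw [hint hw hcu hw0, hint hv hu' hv0, ← ENNReal.ofReal_mul (by positivity)]
  exact (ENNReal.ofReal_le_ofReal (integral_mul_sq_le hab hc hK hu hu' hΨ hΨ' hw hv hw0 hv0 hwΨ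
    hΨK)).trans ENNReal.ofReal_add_le

theorem frequently_mul_le_of_lintegral_ne_top {g : ℝ → ℝ} {A ε : ℝ} (hε : 0 < ε)
    (hg : ∫⁻ x in Ioi A, ENNReal.ofReal (g x) ≠ ⊤) : ∃ᶠ x in atTop, x * g x ≤ ε := by
  intro h
  obtain ⟨B, hB⟩ := eventually_atTop.1 h
  set D := max (max A B) 1
  refine not_integrableOn_Ioi_inv (a := D) ?_
  have hlt : ∫⁻ x in Ioi D, ENNReal.ofReal (ε * x⁻¹) < ⊤ := by
    refine lt_of_le_of_lt ?_ hg.lt_top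
    refine (setLIntegral_mono' measurableSet_Ioi fun x hx => ?_).trans
      (lintegral_mono_set (Ioi_subset_Ioi (le_max_left A B |>.trans (le_max_left _ 1))))
    simp only [D, mem_Ioi, max_lt_iff] at hx
    have hx0 : 0 < x := by linarith
    have := hB x hx.1.2.le
    refine ENNReal.ofReal_le_ofReal ?_
    rw [← div_eq_mul_inv, div_le_iff₀ hx0]
    linarith
  have hi : IntegrableOn (fun x : ℝ => ε * x⁻¹) (Ioi D) := by
    refine ⟨by fun_prop, ?_⟩
    rw [hasFiniteIntegral_iff_ofReal]
    · exact hlt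
    · filter_upwards [ae_restrict_mem measurableSet_Ioi] with x hx
      have : 0 < x := by
        simp only [D, mem_Ioi, max_lt_iff] at hx
        linarith
      simp only [Pi.zero_apply]
      positivity
  simpa [hε.ne', mul_assoc, IntegrableOn] using hi.const_mul ε⁻¹

theorem lintegral_Ioi_le_of_frequently {g : ℝ → ℝ≥0∞} {A : ℝ} {M : ℝ≥0∞}
    (hg : AEMeasurable g (volume.restrict (Ioi A)))
    (h : ∃ᶠ R in atTop, ∫⁻ x in Ioc A R, g x ≤ M) : ∫⁻ x in Ioi A, g x ≤ M := by
  have hlim := ((aecover_Iic (μ := volume) tendsto_id).restrict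
    (s := Ioi A)).lintegral_tendsto_of_countably_generated hg
  simp only [Measure.restrict_restrict measurableSet_Iic, id, Iic_inter_Ioi] at hlim
  exact le_of_tendsto_of_frequently hlim h

/-- The density `r² / (1 + |t - r|) ^ q` of the weight in polar coordinates. -/
def radialWeight (t q r : ℝ) : ℝ := r ^ 2 / (1 + |t - r|) ^ q

theorem continuous_radialWeight (t q : ℝ) : Continuous (radialWeight t q) := by
  unfold radialWeight
  have h0 : ∀ r : ℝ, 1 + |t - r| ≠ 0 := fun r => by positivity
  exact (continuous_id.pow 2).div
    (Continuous.rpow_const (by fun_prop) fun r => Or.inl (h0 r)) fun r => by positivity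

theorem radialWeight_nonneg (t q r : ℝ) : 0 ≤ radialWeight t q r := by
  unfold radialWeight; positivity

theorem radialWeight_eq_mul_rpow_neg (t q r : ℝ) :
    radialWeight t q r = r ^ 2 * (1 + |t - r|) ^ (-q) := by
  rw [radialWeight, Real.rpow_neg (by positivity), div_eq_mul_inv]

theorem lintegral_interior_le {p : ℝ} (hp : -1 < p) {t : ℝ} (ht : 0 < t) {u u' : ℝ → ℝ}
    (hu : ∀ x, HasDerivAt u (u' x) x) (hu' : Continuous u') :
    ∫⁻ x in Ioc 0 (t + 1), ENNReal.ofReal (radialWeight t (2 + p) x * u x ^ 2) ≤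
      ENNReal.ofReal (2 / ((1 + p) * 2 ^ (-(2 + p))) * ((t + 1) ^ 2 * u (t + 1) ^ 2)) +
        ENNReal.ofReal (4 * 2 ^ (2 + 2 * p) / ((1 + p) * 2 ^ (-(2 + p))) ^ 2) *
          ∫⁻ x in Ioc 0 (t + 1), ENNReal.ofReal (radialWeight t p x * u' x ^ 2) := by
  have hp1 : 0 < 1 + p := by linarith
  have hσ : ∀ x ∈ Icc 0 (t + 1), 0 < 2 + t - x := fun x hx => by linarith [hx.2]
  have hS (x : ℝ) : 0 < 1 + |t - x| := by positivity
  have hcσ (q : ℝ) : ContinuousOn (fun x => (2 + t - x) ^ q) (Icc 0 (t + 1)) :=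
    ContinuousOn.rpow_const (by fun_prop) fun x hx => Or.inl (hσ x hx).ne'
  have hc1 := hcσ (-(1 + p))
  have hc2 := hcσ (-(2 + p))
  have h := lintegral_mul_sq_le (a := 0) (b := t + 1) (c := (1 + p) * 2 ^ (-(2 + p)))
    (K := 2 ^ (2 + 2 * p)) (u := u) (u' := u') (w := radialWeight t (2 + p))
    (v := radialWeight t p) (Ψ := fun x => x ^ 2 * (2 + t - x) ^ (-(1 + p)))
    (Ψ' := fun x => 2 * x * (2 + t - x) ^ (-(1 + p)) +
      x ^ 2 * ((1 + p) * (2 + t - x) ^ (-(2 + p))))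
    (by linarith) (by positivity) (by positivity) (fun x _ => hu x) hu'.continuousOn
    (fun x hx => by
      have h1 : HasDerivAt (fun x : ℝ => 2 + t - x) (-1) x := by
        simpa using (hasDerivAt_id x).const_sub (2 + t)
      refine ((hasDerivAt_pow 2 x).mul
        (h1.rpow_const (p := -(1 + p)) (Or.inl (hσ x hx).ne'))).congr_deriv ?_
      rw [show -(1 + p) - 1 = -(2 + p) by ring]
      norm_num)
    (by fun_prop) (continuous_radialWeight _ _).continuousOn
    (continuous_radialWeight _ _).continuousOn (fun x _ => radialWeight_nonneg _ _ _)
    (fun x _ => radialWeight_nonneg _ _ _)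
    (fun x hx => by
      have hle : 2 + t - x ≤ 2 * (1 + |t - x|) := by
        linarith [le_abs_self (t - x), abs_nonneg (t - x)]
      have h1 := Real.rpow_le_rpow_of_nonpos (hσ x hx) hle (z := -(2 + p)) (by linarith)
      rw [Real.mul_rpow (by norm_num) (hS x).le] at h1
      have h2 : 0 ≤ 2 * x * (2 + t - x) ^ (-(1 + p)) :=
        mul_nonneg (by linarith [hx.1]) (Real.rpow_nonneg (hσ x hx).le _)
      rw [radialWeight_eq_mul_rpow_neg]
      have h3 := mul_le_mul_of_nonneg_left h1 (mul_nonneg (sq_nonneg x) hp1.le)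
      linarith)
    (fun x hx => by
      have hle : (1 + |t - x|) / 2 ≤ 2 + t - x := by
        rcases abs_cases (t - x) with h | h <;> linarith [hx.2]
      have h1 := Real.rpow_le_rpow_of_nonpos (by positivity) hle (z := -(2 + 2 * p))
        (by linarith)
      rw [Real.div_rpow (hS x).le (by norm_num), Real.rpow_neg (by norm_num : (0 : ℝ) ≤ 2),
        div_inv_eq_mul] at h1
      rw [radialWeight_eq_mul_rpow_neg, radialWeight_eq_mul_rpow_neg, mul_pow,
        ← Real.rpow_natCast ((2 + t - x) ^ (-(1 + p))) 2, ← Real.rpow_mul (hσ x hx).le]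
      have h2 := mul_le_mul_of_nonneg_left h1 (pow_nonneg (sq_nonneg x) 2)
      have h3 : (1 + |t - x|) ^ (-(2 + 2 * p)) =
          (1 + |t - x|) ^ (-(2 + p)) * (1 + |t - x|) ^ (-p) := by
        rw [← Real.rpow_add (hS x)]; congr 1; ring
      rw [h3] at h2
      rw [show -(1 + p) * ((2 : ℕ) : ℝ) = -(2 + 2 * p) by push_cast; ring]
      generalize (2 : ℝ) ^ (2 + 2 * p) = c at h2 ⊢
      exact h2.trans_eq (by ring))
  have e : 2 + t - (t + 1) = 1 := by ring
  simpa [e] using h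

theorem lintegral_exterior_le {p : ℝ} (hp : -1 < p) (hp1 : p ≠ 1) :
    ∃ C : ℝ, 0 < C ∧ ∀ t : ℝ, 0 < t → ∀ u u' : ℝ → ℝ,
      (∀ x, HasDerivAt u (u' x) x) → Continuous u' →
      ∫⁻ x in Ioi (t + 1), ENNReal.ofReal (radialWeight t (2 + p) x * u x ^ 2) ≠ ⊤ →
      ∫⁻ x in Ioi (t + 1), ENNReal.ofReal (radialWeight t (2 + p) x * u x ^ 2) ≤
        ENNReal.ofReal (C * ((t + 1) ^ 2 * u (t + 1) ^ 2)) +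
          ENNReal.ofReal C *
            ∫⁻ x in Ioi (t + 1), ENNReal.ofReal (radialWeight t p x * u' x ^ 2) := by
  have hp0 : 0 < 1 + p := by linarith
  have hp2 : 1 - p ≠ 0 := sub_ne_zero.2 hp1.symm
  obtain ⟨M, hM⟩ : ∃ M, M = 8 * (1 / |1 - p| + 1 / (1 + p)) := ⟨_, rfl⟩
  have hM0 : 0 < M := by rw [hM]; positivity
  refine ⟨4 * M + 16 * M ^ 2, by positivity, fun t ht u u' hu hu' hfin => ?_⟩
  have hs {x : ℝ} (hx : t + 1 ≤ x) : 2 ≤ 1 + x - t := by linarith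
  have habs {x : ℝ} (hx : t + 1 ≤ x) : 1 + |t - x| = 1 + x - t := by
    rw [abs_of_nonpos (by linarith)]; ring
  set Ψ : ℝ → ℝ := fun x =>
    (1 + x - t) ^ (1 - p) / (1 - p) - t ^ 2 * (1 + x - t) ^ (-(1 + p)) / (1 + p) with hΨdef
  have hwt (q : ℝ) {x : ℝ} (hx : t + 1 ≤ x) :
      radialWeight t q x = x ^ 2 * (1 + x - t) ^ (-q) := by
    rw [radialWeight_eq_mul_rpow_neg, habs hx]
  have hΨle {x : ℝ} (hx : t + 1 ≤ x) : |Ψ x| ≤ M * (x ^ 2 * (1 + x - t) ^ (-(1 + p))) := by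
    have h2 := hs hx
    have hpos : 0 < 1 + x - t := by linarith
    have e1 : (1 + x - t) ^ (1 - p) = (1 + x - t) ^ 2 * (1 + x - t) ^ (-(1 + p)) := by
      rw [← Real.rpow_natCast _ 2, ← Real.rpow_add hpos]; congr 1; push_cast; ring
    have e2 : Ψ x = ((1 + x - t) ^ 2 / (1 - p) - t ^ 2 / (1 + p)) *
        (1 + x - t) ^ (-(1 + p)) := by
      simp only [hΨdef, e1]; ring
    rw [e2, abs_mul, abs_of_pos (Real.rpow_pos_of_pos hpos _), ← mul_assoc]
    refine mul_le_mul_of_nonneg_right ?_ (Real.rpow_nonneg hpos.le _)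
    refine (abs_sub _ _).trans ?_
    rw [abs_div, abs_div, abs_of_nonneg (sq_nonneg (1 + x - t)), abs_of_nonneg (sq_nonneg t),
      abs_of_pos hp0, hM]
    have i1 : (1 + x - t) ^ 2 / |1 - p| ≤ 8 * x ^ 2 / |1 - p| := by gcongr; nlinarith
    have i2 : t ^ 2 / (1 + p) ≤ 8 * x ^ 2 / (1 + p) := by gcongr; nlinarith
    refine (add_le_add i1 i2).trans (le_of_eq ?_)
    ring
  have hcpow (q : ℝ) {R : ℝ} : ContinuousOn (fun x => (1 + x - t) ^ q) (Icc (t + 1) R) :=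
    ContinuousOn.rpow_const (by fun_prop) fun x hx => Or.inl (by linarith [hx.1])
  have hfinite {R : ℝ} (hR : t + 1 ≤ R) := by
    have hc1 := hcpow (-p) (R := R)
    have hc2 := hcpow (-(2 + p)) (R := R)
    exact lintegral_mul_sq_le (a := t + 1) (b := R) (c := 1 / 2)
      (K := M ^ 2) (u := u) (u' := u') (w := radialWeight t (2 + p))
      (v := radialWeight t p) (Ψ := Ψ)
      (Ψ' := fun x => (1 + x - t) ^ (-p) + t ^ 2 * (1 + x - t) ^ (-(2 + p)))
      hR (by positivity) (by positivity) (fun x _ => hu x) hu'.continuousOn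
      (fun x hx => by
        have hne : 1 + x - t ≠ 0 := by linarith [hs hx.1]
        have h1 : HasDerivAt (fun x : ℝ => 1 + x - t) 1 x := by
          simpa using ((hasDerivAt_id x).const_add 1).sub_const t
        refine (((h1.rpow_const (p := 1 - p) (Or.inl hne)).div_const (1 - p)).sub
          (((h1.rpow_const (p := -(1 + p)) (Or.inl hne)).const_mul (t ^ 2)).div_const
            (1 + p))).congr_deriv ?_
        rw [show -(1 + p) - 1 = -(2 + p) by ring, show 1 - p - 1 = -p by ring]
        field_simp
        ring)
      (by fun_prop) (continuous_radialWeight _ _).continuousOn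
      (continuous_radialWeight _ _).continuousOn (fun x _ => radialWeight_nonneg _ _ _)
      (fun x _ => radialWeight_nonneg _ _ _)
      (fun x hx => by
        have hpos : 0 < 1 + x - t := by linarith [hs hx.1]
        have e1 : (1 + x - t) ^ (-p) = (1 + x - t) ^ 2 * (1 + x - t) ^ (-(2 + p)) := by
          rw [← Real.rpow_natCast _ 2, ← Real.rpow_add hpos]; congr 1; push_cast; ring
        rw [hwt _ hx.1, e1, ← add_mul, ← mul_assoc]
        refine mul_le_mul_of_nonneg_right ?_ (Real.rpow_nonneg hpos.le _)
        nlinarith [sq_nonneg (1 + x - t - t), hx.1])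
      (fun x hx => by
        have hpos : 0 < 1 + x - t := by linarith [hs hx.1]
        refine (sq_le_sq.2 ((hΨle hx.1).trans (le_abs_self _))).trans (le_of_eq ?_)
        have e3 : ((1 + x - t) ^ (-(1 + p))) ^ 2 =
            (1 + x - t) ^ (-(2 + p)) * (1 + x - t) ^ (-p) := by
          rw [← Real.rpow_natCast _ 2, ← Real.rpow_mul hpos.le, ← Real.rpow_add hpos]
          congr 1; push_cast; ring
        rw [hwt _ hx.1, hwt _ hx.1, mul_pow, mul_pow, e3]
        ring)
  have hstart : |Ψ (t + 1)| ≤ M * (t + 1) ^ 2 := by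
    refine (hΨle le_rfl).trans ?_
    rw [show 1 + (t + 1) - t = 2 by ring]
    have : (2 : ℝ) ^ (-(1 + p)) ≤ 1 :=
      Real.rpow_le_one_of_one_le_of_nonpos (by norm_num) (by linarith)
    have := mul_le_mul_of_nonneg_left this (mul_nonneg hM0.le (sq_nonneg (t + 1)))
    linarith
  refine ENNReal.le_of_forall_pos_le_add fun ε hε _ => ?_
  have hε' : 0 < (ε : ℝ) / (8 * M) := by positivity
  refine lintegral_Ioi_le_of_frequently (Continuous.aemeasurable ?_) ?_
  · have hcu : Continuous u := continuous_iff_continuousAt.2 fun x => (hu x).continuousAt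
    exact ENNReal.continuous_ofReal.comp
      ((continuous_radialWeight _ _).mul (hcu.pow 2))
  refine ((frequently_mul_le_of_lintegral_ne_top hε' hfin).and_eventually
    (eventually_ge_atTop (t + 1))).mono fun R ⟨hRε, hR⟩ => (hfinite hR).trans ?_
  have hend : Ψ R * u R ^ 2 ≤ ε / 4 := by
    have hpos : 0 < 1 + R - t := by linarith [hs hR]
    have e1 : (1 + R - t) ^ (-(1 + p)) = (1 + R - t) * (1 + R - t) ^ (-(2 + p)) := by
      nth_rewrite 2 [← Real.rpow_one (1 + R - t)]
      rw [← Real.rpow_add hpos]; congr 1; ring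
    calc Ψ R * u R ^ 2 ≤ M * (R ^ 2 * (1 + R - t) ^ (-(1 + p))) * u R ^ 2 :=
          mul_le_mul_of_nonneg_right ((le_abs_self _).trans (hΨle hR)) (sq_nonneg _)
      _ = M * (1 + R - t) * (radialWeight t (2 + p) R * u R ^ 2) := by
          rw [hwt _ hR, e1]; ring
      _ ≤ M * (2 * R) * (radialWeight t (2 + p) R * u R ^ 2) := by
          gcongr
          · exact mul_nonneg (radialWeight_nonneg _ _ _) (sq_nonneg _)
          · linarith
      _ = 2 * M * (R * (radialWeight t (2 + p) R * u R ^ 2)) := by ring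
      _ ≤ 2 * M * (ε / (8 * M)) := by gcongr
      _ = ε / 4 := by field_simp; norm_num
  have hstart' : -(Ψ (t + 1) * u (t + 1) ^ 2) ≤ M * ((t + 1) ^ 2 * u (t + 1) ^ 2) := by
    have := mul_le_mul_of_nonneg_right ((neg_le_abs _).trans hstart) (sq_nonneg (u (t + 1)))
    linarith
  have hB : 0 ≤ (t + 1) ^ 2 * u (t + 1) ^ 2 := by positivity
  have hbdry : ENNReal.ofReal (2 / (1 / 2) * (Ψ R * u R ^ 2 - Ψ (t + 1) * u (t + 1) ^ 2)) ≤
      ENNReal.ofReal ((4 * M + 16 * M ^ 2) * ((t + 1) ^ 2 * u (t + 1) ^ 2)) + ε := by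
    rw [← ENNReal.ofReal_coe_nnreal, ← ENNReal.ofReal_add (by positivity) ε.coe_nonneg]
    refine ENNReal.ofReal_le_ofReal ?_
    nlinarith [mul_nonneg (sq_nonneg M) hB]
  rw [add_right_comm]
  refine add_le_add hbdry (mul_le_mul' (ENNReal.ofReal_le_ofReal ?_)
    (lintegral_mono_set Ioc_subset_Ioi_self))
  norm_num
  linarith

theorem lintegral_radial_le {p : ℝ} (hp : -1 < p) (hp1 : p ≠ 1) :
    ∃ C : ℝ, 0 < C ∧ ∀ t : ℝ, 0 < t → ∀ u u' : ℝ → ℝ,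
      (∀ x, HasDerivAt u (u' x) x) → Continuous u' →
      ∫⁻ x in Ioi 0, ENNReal.ofReal (radialWeight t (2 + p) x * u x ^ 2) ≠ ⊤ →
      ∫⁻ x in Ioi 0, ENNReal.ofReal (radialWeight t (2 + p) x * u x ^ 2) ≤
        ENNReal.ofReal C * ENNReal.ofReal ((t + 1) ^ 2 * u (t + 1) ^ 2) +
          ENNReal.ofReal C *
            ∫⁻ x in Ioi 0, ENNReal.ofReal (radialWeight t p x * u' x ^ 2) := by
  obtain ⟨C, hC, h⟩ := lintegral_exterior_le hp hp1
  have hp0 : 0 < 1 + p := by linarith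
  obtain ⟨a, ha⟩ : ∃ a : ℝ, a = 2 / ((1 + p) * 2 ^ (-(2 + p))) := ⟨_, rfl⟩
  obtain ⟨b, hb⟩ : ∃ b : ℝ, b = 4 * 2 ^ (2 + 2 * p) / ((1 + p) * 2 ^ (-(2 + p))) ^ 2 := ⟨_, rfl⟩
  have ha0 : 0 < a := by rw [ha]; positivity
  have hb0 : 0 < b := by rw [hb]; positivity
  refine ⟨a + b + C, by positivity, fun t ht u u' hu hu' hfin => ?_⟩
  have hsplit (g : ℝ → ℝ≥0∞) : ∫⁻ x in Ioi 0, g x =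
      (∫⁻ x in Ioc 0 (t + 1), g x) + ∫⁻ x in Ioi (t + 1), g x := by
    rw [← lintegral_union measurableSet_Ioi (Ioc_disjoint_Ioi le_rfl),
      Ioc_union_Ioi_eq_Ioi (by positivity)]
  have hext := h t ht u u' hu hu' (ne_top_of_le_ne_top hfin
    (lintegral_mono_set (Ioi_subset_Ioi (by positivity))))
  have hint := lintegral_interior_le hp ht hu hu'
  rw [← ha, ← hb, ENNReal.ofReal_mul ha0.le] at hint
  rw [ENNReal.ofReal_mul hC.le] at hext
  rw [hsplit, hsplit]
  refine (add_le_add hint hext).trans ?_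
  rw [add_add_add_comm, ← add_mul, mul_add (ENNReal.ofReal (a + b + C)),
    ← ENNReal.ofReal_add ha0.le hC.le]
  gcongr <;> linarith

/-- Integration in polar coordinates for the Lebesgue integral. -/
theorem lintegral_eq_lintegral_toSphere {E : Type*} [NormedAddCommGroup E] [NormedSpace ℝ E]
    [FiniteDimensional ℝ E] [Nontrivial E] [MeasurableSpace E] [BorelSpace E] (μ : Measure E)
    [μ.IsAddHaarMeasure] {g : E → ℝ≥0∞} (hg : Measurable g) :
    ∫⁻ x, g x ∂μ = ∫⁻ ω : sphere (0 : E) 1, (∫⁻ r in Ioi (0 : ℝ),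
      ENNReal.ofReal (r ^ (Module.finrank ℝ E - 1)) * g (r • (ω : E))) ∂μ.toSphere := by
  have hm : Measurable fun z : sphere (0 : E) 1 × Ioi (0 : ℝ) => g ((z.2 : ℝ) • (z.1 : E)) :=
    hg.comp (by fun_prop)
  calc ∫⁻ x, g x ∂μ = ∫⁻ x : ({(0)}ᶜ : Set E), g x ∂(μ.comap (↑)) := by
        rw [lintegral_subtype_comap (measurableSet_singleton _).compl, restrict_compl_singleton]
    _ = ∫⁻ z : sphere (0 : E) 1 × Ioi (0 : ℝ), g ((z.2 : ℝ) • (z.1 : E))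
          ∂μ.toSphere.prod (.volumeIoiPow (Module.finrank ℝ E - 1)) := by
        rw [← μ.measurePreserving_homeomorphUnitSphereProd.lintegral_comp hm]
        refine lintegral_congr fun x => ?_
        congr 1
        exact congrArg Subtype.val ((homeomorphUnitSphereProd E).symm_apply_apply x).symm
    _ = _ := by
        rw [lintegral_prod _ hm.aemeasurable]
        refine lintegral_congr fun ω => ?_
        rw [Measure.volumeIoiPow, lintegral_withDensity_eq_lintegral_mul _ (by fun_prop)
          (g := fun r : Ioi (0 : ℝ) => g ((r : ℝ) • (ω : E))) (hg.comp (by fun_prop))]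
        exact lintegral_subtype_comap measurableSet_Ioi
          fun r : ℝ => ENNReal.ofReal (r ^ (Module.finrank ℝ E - 1)) * g (r • (ω : E))

theorem measurable_radDeriv {f : EuclideanSpace ℝ (Fin 3) → ℝ} (hf : ContDiff ℝ (⊤ : ℕ∞) f) :
    Measurable (radDeriv f) := by
  have h1 : Measurable (fderiv ℝ f) := (hf.continuous_fderiv (by simp)).measurable
  have h2 : Measurable fun x : EuclideanSpace ℝ (Fin 3) => ‖x‖⁻¹ • x := by fun_prop
  exact isBoundedBilinearMap_apply.continuous.measurable.comp (h1.prodMk h2)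

theorem radDeriv_smul (f : EuclideanSpace ℝ (Fin 3) → ℝ) {r : ℝ} (hr : 0 < r)
    {ω : EuclideanSpace ℝ (Fin 3)} (hω : ‖ω‖ = 1) :
    radDeriv f (r • ω) = fderiv ℝ f (r • ω) ω := by
  rw [radDeriv, norm_smul, hω, mul_one, Real.norm_of_nonneg hr.le, inv_smul_smul₀ hr.ne']

theorem ofReal_sq_mul_ofReal_div (t q : ℝ) {r y : ℝ} (hr : 0 < r)
    {ω : EuclideanSpace ℝ (Fin 3)} (hω : ‖ω‖ = 1) :
    ENNReal.ofReal (r ^ 2) * ENNReal.ofReal (y ^ 2 / (1 + |t - ‖r • ω‖|) ^ q) =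
      ENNReal.ofReal (radialWeight t q r * y ^ 2) := by
  rw [← ENNReal.ofReal_mul (by positivity), norm_smul, hω, mul_one, Real.norm_of_nonneg hr.le,
    radialWeight]
  congr 1
  ring

/-- Lemma 9.1: weighted Poincaré inequality with a boundary term on the sphere of
radius `t+1`. -/
theorem weighted_poincare_inequality
    (γ : ℝ) (hγ₁ : -(1/2) < γ) (hγ₂ : γ ≠ 1/2) :
    ∃ C : ℝ, 0 < C ∧
      ∀ t : ℝ, 0 < t →
      ∀ f : EuclideanSpace ℝ (Fin 3) → ℝ, ContDiff ℝ (⊤ : ℕ∞) f →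
        (∫⁻ x : EuclideanSpace ℝ (Fin 3),
            ENNReal.ofReal ((f x) ^ 2 / (1 + |t - ‖x‖|) ^ ((2:ℝ) + 2 * γ))) ≠ ⊤ →
        (∫⁻ x : EuclideanSpace ℝ (Fin 3),
            ENNReal.ofReal ((f x) ^ 2 / (1 + |t - ‖x‖|) ^ ((2:ℝ) + 2 * γ)))
          ≤ ENNReal.ofReal C * sphereLintegral (t + 1) (fun x => ENNReal.ofReal ((f x) ^ 2))
            + ENNReal.ofReal C *
              ∫⁻ x : EuclideanSpace ℝ (Fin 3),
                ENNReal.ofReal ((radDeriv f x) ^ 2 / (1 + |t - ‖x‖|) ^ (2 * γ)) := by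
  obtain ⟨C, hC, h⟩ := lintegral_radial_le (p := 2 * γ) (by linarith)
    (fun h => hγ₂ (by linarith))
  refine ⟨C, hC, fun t ht f hf hfin => ?_⟩
  have hfm : Measurable f := hf.continuous.measurable
  have hdm := measurable_radDeriv hf
  have hm1 : Measurable fun x : EuclideanSpace ℝ (Fin 3) =>
      ENNReal.ofReal ((f x) ^ 2 / (1 + |t - ‖x‖|) ^ ((2:ℝ) + 2 * γ)) := by fun_prop
  have hm2 : Measurable fun x : EuclideanSpace ℝ (Fin 3) =>
      ENNReal.ofReal ((radDeriv f x) ^ 2 / (1 + |t - ‖x‖|) ^ (2 * γ)) := by fun_prop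
  have hpolar : ∀ {g : EuclideanSpace ℝ (Fin 3) → ℝ≥0∞}, Measurable g → ∫⁻ x, g x =
      ∫⁻ ω : sphere (0 : EuclideanSpace ℝ (Fin 3)) 1, (∫⁻ r in Ioi (0 : ℝ),
        ENNReal.ofReal (r ^ 2) * g (r • (ω : EuclideanSpace ℝ (Fin 3)))) ∂volume.toSphere :=
    fun hg => by simpa using lintegral_eq_lintegral_toSphere volume hg
  have hslice : ∀ {g : EuclideanSpace ℝ (Fin 3) → ℝ≥0∞}, Measurable g →
      Measurable fun ω : sphere (0 : EuclideanSpace ℝ (Fin 3)) 1 => ∫⁻ r in Ioi (0 : ℝ),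
        ENNReal.ofReal (r ^ 2) * g (r • (ω : EuclideanSpace ℝ (Fin 3))) := fun {g} hg => by
    refine Measurable.lintegral_prod_right'
      (f := fun z : sphere (0 : EuclideanSpace ℝ (Fin 3)) 1 × ℝ =>
        ENNReal.ofReal (z.2 ^ 2) * g (z.2 • (z.1 : EuclideanSpace ℝ (Fin 3)))) ?_
    exact Measurable.mul (by fun_prop) (hg.comp (by fun_prop))
  rw [hpolar hm1] at hfin ⊢
  rw [hpolar hm2, sphereLintegral, ← lintegral_const_mul' _ _ ENNReal.ofReal_ne_top,
    ← lintegral_const_mul' _ _ ENNReal.ofReal_ne_top,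
    ← lintegral_const_mul' _ _ ENNReal.ofReal_ne_top,
    ← lintegral_add_right _ ((hslice hm2).const_mul _)]
  refine lintegral_mono_ae ?_
  filter_upwards [ae_lt_top (hslice hm1) hfin] with ω hωfin
  have hω : ‖(ω : EuclideanSpace ℝ (Fin 3))‖ = 1 := by simp
  have e1 : ∫⁻ r in Ioi (0 : ℝ), ENNReal.ofReal (r ^ 2) *
      ENNReal.ofReal (f (r • ω.1) ^ 2 / (1 + |t - ‖r • ω.1‖|) ^ ((2:ℝ) + 2 * γ)) =
      ∫⁻ r in Ioi (0 : ℝ), ENNReal.ofReal (radialWeight t (2 + 2 * γ) r * f (r • ω.1) ^ 2) :=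
    setLIntegral_congr_fun measurableSet_Ioi fun r hr => ofReal_sq_mul_ofReal_div _ _ hr hω
  have e2 : ∫⁻ r in Ioi (0 : ℝ), ENNReal.ofReal (r ^ 2) *
      ENNReal.ofReal (radDeriv f (r • ω.1) ^ 2 / (1 + |t - ‖r • ω.1‖|) ^ (2 * γ)) =
      ∫⁻ r in Ioi (0 : ℝ), ENNReal.ofReal (radialWeight t (2 * γ) r *
        fderiv ℝ f (r • ω.1) ω.1 ^ 2) :=
    setLIntegral_congr_fun measurableSet_Ioi fun r hr => by
      rw [← radDeriv_smul f hr hω]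
      exact ofReal_sq_mul_ofReal_div _ _ hr hω
  rw [e1] at hωfin ⊢
  rw [e2, ← ENNReal.ofReal_mul (by positivity)]
  refine h t ht (fun r => f (r • ω.1)) (fun r => fderiv ℝ f (r • ω.1) ω.1) (fun r => ?_) ?_
    hωfin.ne
  · have hline : HasDerivAt (fun r : ℝ => r • ω.1) ω.1 r := by
      simpa using (hasDerivAt_id r).smul_const ω.1
    exact ((hf.differentiable (by simp)) (r • ω.1)).hasFDerivAt.comp_hasDerivAt r hline
  · exact ((hf.continuous_fderiv (by simp)).comp (by fun_prop)).clm_apply continuous_const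

end LindbladRodnianski
end
end
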